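/- arXiv:1411.0474 — 3 statements merged into one kernel-verified Lean document; each statement's English description precedes it below -/
import Mathlib

section
/- Let T be a tree on n vertices that is neither a path nor a star, let S be the bi-coloured system derived from T, and let a be the number of leaves of T having at least one twin. Then m_S(R) = C(a,2) + a + 1 holds if and only if either T is isomorphic to S(p, q) for some integers p ≥ 2 and q ≥ 3, or T is obtained from a path on q ≥ 2 vertices by attaching p₁ ≥ 2 pendant leaves to one endpoint of the path and p₂ ≥ 2 pendant leaves to the other endpoint. -/
/-- Three vertices `x, y, z` of a graph are collinear if one of them lies on a
shortest path (in a tree: the unique path) between the other two, i.e.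
`d(x,y) + d(y,z) = d(x,z)` for some ordering of the triple. -/
def Collin {V : Type*} (G : SimpleGraph V) (x y z : V) : Prop :=
  G.dist x y + G.dist y z = G.dist x z ∨
  G.dist y x + G.dist x z = G.dist y z ∨
  G.dist x z + G.dist z y = G.dist x y

/-- The red line generated by two distinct vertices `u`, `v` in the bi-coloured
system derived from the graph `G`: a triple is red iff it is collinear. -/
def treeRedLine {V : Type*} (G : SimpleGraph V) (u v : V) : Set V :=
  {u, v} ∪ {p | p ≠ u ∧ p ≠ v ∧ Collin G u v p}

/-- The blue line generated by two distinct vertices `u`, `v` in the bi-coloured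
system derived from the graph `G`: a triple is blue iff it is not collinear. -/
def treeBlueLine {V : Type*} (G : SimpleGraph V) (u v : V) : Set V :=
  {u, v} ∪ {p | p ≠ u ∧ p ≠ v ∧ ¬ Collin G u v p}

/-- The set of distinct red lines of the system derived from `G`. -/
def treeRedLines {V : Type*} (G : SimpleGraph V) : Set (Set V) :=
  {L | ∃ u v : V, u ≠ v ∧ L = treeRedLine G u v}

/-- The set of distinct blue lines of the system derived from `G`. -/
def treeBlueLines {V : Type*} (G : SimpleGraph V) : Set (Set V) :=
  {L | ∃ u v : V, u ≠ v ∧ L = treeBlueLine G u v}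

/-- `m_S(R)`, the number of distinct red lines of the system derived from `G`. -/
noncomputable def treeNumRed {V : Type*} (G : SimpleGraph V) : ℕ :=
  (treeRedLines G).ncard

/-- `m_S(B)`, the number of distinct blue lines of the system derived from `G`. -/
noncomputable def treeNumBlue {V : Type*} (G : SimpleGraph V) : ℕ :=
  (treeBlueLines G).ncard

/-- Two vertices are twins if they are distinct, non-adjacent and have identical
neighbourhoods. -/
def Twins {V : Type*} (G : SimpleGraph V) (x y : V) : Prop :=
  x ≠ y ∧ ¬ G.Adj x y ∧ G.neighborSet x = G.neighborSet y

/-- The set of leaves of `G` having at least one twin (the set `A`). -/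
def twinLeaves {V : Type*} (G : SimpleGraph V) : Set V :=
  {v | (G.neighborSet v).ncard = 1 ∧ ∃ w, Twins G v w}

/-- A twin class of a graph: a maximal set of at least two pairwise twin
vertices, i.e. the set consisting of a vertex `v` having a twin together with
all twins of `v`. -/
def IsTwinClass {V : Type*} (G : SimpleGraph V) (C : Set V) : Prop :=
  ∃ v w : V, Twins G v w ∧ C = {u | u = v ∨ Twins G v u}

/-- `s`, the number of twin classes of `G`. -/
noncomputable def numTwinClasses {V : Type*} (G : SimpleGraph V) : ℕ :=
  {C : Set V | IsTwinClass G C}.ncard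

/-- The tree `S(p, q)`: a path on `q` vertices (`0, 1, …, q−1`) with `p` pendant
leaves (`q, …, q+p−1`) attached to the endpoint `q−1` of the path. -/
def Spq (p q : ℕ) : SimpleGraph (Fin (q + p)) :=
  SimpleGraph.fromRel (fun i j =>
    ((i : ℕ) + 1 = (j : ℕ) ∧ (j : ℕ) < q) ∨ ((i : ℕ) = q - 1 ∧ q ≤ (j : ℕ)))

/-- The double broom: a path on `q` vertices (`0, …, q−1`) with `p₁` pendant
leaves (`q, …, q+p₁−1`) attached to the endpoint `0` and `p₂` pendant leaves
(`q+p₁, …, q+p₁+p₂−1`) attached to the other endpoint `q−1`. -/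
def DoubleBroom (p₁ p₂ q : ℕ) : SimpleGraph (Fin (q + p₁ + p₂)) :=
  SimpleGraph.fromRel (fun i j =>
    ((i : ℕ) + 1 = (j : ℕ) ∧ (j : ℕ) < q) ∨
    ((i : ℕ) = 0 ∧ q ≤ (j : ℕ) ∧ (j : ℕ) < q + p₁) ∨
    ((i : ℕ) = q - 1 ∧ q + p₁ ≤ (j : ℕ)))

namespace TreeLines

variable {V : Type*} {G : SimpleGraph V}

section Distances

theorem exists_adj_dist (hG : G.Connected) {u z : V} (h : u ≠ z) :
    ∃ w, G.Adj u w ∧ G.dist w z + 1 = G.dist u z := by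
  obtain ⟨p, hp⟩ := hG.exists_walk_length_eq_dist u z
  cases p with
  | nil => exact absurd rfl h
  | @cons _ w _ a q =>
    refine ⟨w, a, ?_⟩
    have h₁ := SimpleGraph.dist_le q
    have h₂ := hG.dist_triangle (u := u) (v := w) (w := z)
    rw [SimpleGraph.dist_eq_one_iff_adj.2 a] at h₂
    rw [SimpleGraph.Walk.length_cons] at hp
    omega

theorem dist_step (hG : G.IsTree) {u w : V} (h : G.Adj u w) (z : V) :
    G.dist u z = G.dist w z + 1 ∨ G.dist w z = G.dist u z + 1 := by
  have h₁ := hG.dist_ne_of_adj z h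
  have h₂ := hG.connected.dist_triangle (u := u) (v := w) (w := z)
  have h₃ := hG.connected.dist_triangle (u := w) (v := u) (w := z)
  rw [SimpleGraph.dist_eq_one_iff_adj.2 h] at h₂
  rw [SimpleGraph.dist_eq_one_iff_adj.2 h.symm] at h₃
  rw [G.dist_comm, G.dist_comm (u := z)] at h₁
  omega

theorem closer_neighbor_unique (hG : G.IsTree) {c w w' z : V} (h : G.Adj c w) (h' : G.Adj c w')
    (hw : G.dist w z < G.dist c z) (hw' : G.dist w' z < G.dist c z) : w = w' := by
  obtain ⟨p, hp⟩ := hG.connected.exists_walk_length_eq_dist w z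
  obtain ⟨q, hq⟩ := hG.connected.exists_walk_length_eq_dist w' z
  have hp' : (SimpleGraph.Walk.cons h p).IsPath :=
    SimpleGraph.Walk.isPath_of_length_eq_dist _ (by
      rw [SimpleGraph.Walk.length_cons]; have := dist_step hG h z; omega)
  have hq' : (SimpleGraph.Walk.cons h' q).IsPath :=
    SimpleGraph.Walk.isPath_of_length_eq_dist _ (by
      rw [SimpleGraph.Walk.length_cons]; have := dist_step hG h' z; omega)
  have := congrArg SimpleGraph.Walk.snd ((hG.existsUnique_path c z).unique hp' hq')
  simpa using this

/-- A vertex `m` lies between `v` and `p` unless some neighbour of `m` is closer to both. -/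
theorem between_or_exists_closer (hG : G.IsTree) (p m : V) (n : ℕ) :
    ∀ v, G.dist v m = n → G.dist v m + G.dist m p = G.dist v p ∨
      ∃ w, G.Adj m w ∧ G.dist w v < G.dist m v ∧ G.dist w p < G.dist m p := by
  have hc := hG.connected
  induction n with
  | zero =>
    intro v hv
    obtain rfl := hc.dist_eq_zero_iff.1 hv
    simp
  | succ n ih =>
    intro v hv
    have hvm : v ≠ m := by rintro rfl; simp at hv
    obtain ⟨v', ha, hv'⟩ := exists_adj_dist hc hvm
    rcases ih v' (by omega) with h | ⟨w, hw, h₁, h₂⟩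
    · rcases dist_step hG ha p with h' | h'
      · left; omega
      · right
        by_cases hm : v' = m
        · subst hm
          have := dist_step hG ha v
          rw [G.dist_self] at this
          exact ⟨v, ha.symm, by rw [G.dist_self]; omega, by omega⟩
        · exfalso
          obtain ⟨v'', ha', hv''⟩ := exists_adj_dist hc hm
          have := hc.dist_triangle (u := v'') (v := m) (w := p)
          have := closer_neighbor_unique hG ha.symm ha' (z := p) (by omega) (by omega)
          subst this
          omega
    · right
      refine ⟨w, hw, ?_, h₂⟩
      have h₃ := dist_step hG ha w
      have h₄ := dist_step hG ha m
      have h₅ := G.dist_comm (u := v) (v := w)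
      have h₆ := G.dist_comm (u := v') (v := w)
      have h₇ := G.dist_comm (u := v) (v := m)
      have h₈ := G.dist_comm (u := v') (v := m)
      omega

end Distances

section Collinearity

theorem Collin.rotate {x y z : V} : Collin G x y z → Collin G y z x := by
  unfold Collin
  have := G.dist_comm (u := x) (v := y)
  have := G.dist_comm (u := x) (v := z)
  have := G.dist_comm (u := y) (v := z)
  omega

theorem Collin.swap {x y z : V} : Collin G x y z → Collin G y x z := by
  unfold Collin
  have := G.dist_comm (u := x) (v := y)
  have := G.dist_comm (u := x) (v := z)
  have := G.dist_comm (u := y) (v := z)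
  omega

theorem Collin.swap_right {x y z : V} (h : Collin G x y z) : Collin G x z y :=
  Collin.swap (Collin.rotate (Collin.rotate h))

theorem mem_redLine {u v p : V} : p ∈ treeRedLine G u v ↔ Collin G u v p := by
  simp only [treeRedLine, Set.mem_union, Set.mem_insert_iff, Set.mem_singleton_iff,
    Set.mem_ofPred_eq]
  constructor
  · rintro ((rfl | rfl) | h)
    · right; left; simp
    · left; simp
    · exact h.2.2
  · tauto

theorem left_mem_redLine (u v : V) : u ∈ treeRedLine G u v := by simp [treeRedLine]

theorem right_mem_redLine (u v : V) : v ∈ treeRedLine G u v := by simp [treeRedLine]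

theorem redLine_comm (u v : V) : treeRedLine G u v = treeRedLine G v u := by
  ext p
  rw [mem_redLine, mem_redLine]
  exact ⟨Collin.swap, Collin.swap⟩

theorem collin_of_adj (hG : G.IsTree) {u v : V} (h : G.Adj u v) (p : V) : Collin G u v p := by
  unfold Collin
  have h₁ := SimpleGraph.dist_eq_one_iff_adj.2 h
  have h₂ := SimpleGraph.dist_eq_one_iff_adj.2 h.symm
  have h₃ := dist_step hG h p
  have := G.dist_comm (u := v) (v := p)
  omega

end Collinearity

section Leaves

/-- `x` is a leaf whose only neighbour is `c`. -/
def LeafAt (G : SimpleGraph V) (x c : V) : Prop := G.Adj x c ∧ ∀ z, G.Adj x z → z = c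

/-- `x` and `y` are distinct leaves with the same neighbour. -/
def TwinLeaves (G : SimpleGraph V) (x y : V) : Prop := x ≠ y ∧ ∃ c, LeafAt G x c ∧ LeafAt G y c

theorem TwinLeaves.symm {x y : V} (h : TwinLeaves G x y) : TwinLeaves G y x :=
  ⟨h.1.symm, h.2.imp fun _ hc => hc.symm⟩

theorem LeafAt.eq {x c d : V} (h : LeafAt G x c) (h' : LeafAt G x d) : c = d := h'.2 _ h.1

theorem twins_iff (hG : G.IsTree) {x y : V} : Twins G x y ↔ TwinLeaves G x y := by
  constructor
  · rintro ⟨hne, -, hN⟩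
    have hmem : ∀ z, G.Adj x z ↔ G.Adj y z := fun z => by
      simpa using Set.ext_iff.1 hN z
    obtain ⟨c, hc, hd⟩ := exists_adj_dist hG.connected hne
    have hxy : G.dist x y = 2 := by
      have := SimpleGraph.dist_eq_one_iff_adj.2 ((hmem c).1 hc).symm
      omega
    have huniq : ∀ z, G.Adj x z → z = c := fun z hz =>
      closer_neighbor_unique hG hz hc
        (by rw [SimpleGraph.dist_eq_one_iff_adj.2 ((hmem z).1 hz).symm]; omega) (by omega)
    exact ⟨hne, c, ⟨hc, huniq⟩, (hmem c).1 hc, fun z hz => huniq z ((hmem z).2 hz)⟩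
  · rintro ⟨hne, c, hx, hy⟩
    have hmem : ∀ z, G.Adj x z ↔ G.Adj y z := fun z =>
      ⟨fun h => by rw [hx.2 z h]; exact hy.1, fun h => by rw [hy.2 z h]; exact hx.1⟩
    refine ⟨hne, fun h => ?_, by ext z; simpa using hmem z⟩
    exact G.irrefl ((hmem y).1 h)

theorem mem_twinLeaves (hG : G.IsTree) {x : V} : x ∈ twinLeaves G ↔ ∃ y, TwinLeaves G x y := by
  simp only [twinLeaves, Set.mem_ofPred_eq, twins_iff hG, and_iff_right_iff_imp]
  rintro ⟨y, -, c, hx, -⟩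
  rw [Set.ncard_eq_one]
  refine ⟨c, Set.ext fun z => ?_⟩
  simp only [SimpleGraph.mem_neighborSet, Set.mem_singleton_iff]
  exact ⟨hx.2 z, fun h => h ▸ hx.1⟩

theorem LeafAt.dist (hG : G.IsTree) {x c z : V} (h : LeafAt G x c) (hz : x ≠ z) :
    G.dist c z + 1 = G.dist x z := by
  obtain ⟨w, hw, hd⟩ := exists_adj_dist hG.connected hz
  rwa [← h.2 w hw]

theorem LeafAt.not_between (hG : G.IsTree) {x c y z : V} (h : LeafAt G x c) (hy : x ≠ y)
    (hz : x ≠ z) : G.dist y x + G.dist x z ≠ G.dist y z := by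
  have h₁ := h.dist hG hy
  have h₂ := h.dist hG hz
  have := hG.connected.dist_triangle (u := y) (v := c) (w := z)
  rw [G.dist_comm (u := y) (v := c)] at this
  rw [G.dist_comm (u := y) (v := x)]
  omega

theorem TwinLeaves.dist_eq (hG : G.IsTree) {x y z : V} (h : TwinLeaves G x y) (hx : z ≠ x)
    (hy : z ≠ y) : G.dist x z = G.dist y z := by
  obtain ⟨-, c, h₁, h₂⟩ := h
  rw [← h₁.dist hG hx.symm, ← h₂.dist hG hy.symm]

theorem TwinLeaves.dist (hG : G.IsTree) {x y : V} (h : TwinLeaves G x y) : G.dist x y = 2 := by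
  obtain ⟨hne, c, h₁, h₂⟩ := h
  rw [← h₁.dist hG hne, SimpleGraph.dist_eq_one_iff_adj.2 h₂.1.symm]

theorem not_collin_of_leaves (hG : G.IsTree) {x y z cx cy cz : V} (hx : LeafAt G x cx)
    (hy : LeafAt G y cy) (hz : LeafAt G z cz) (hxy : x ≠ y) (hxz : x ≠ z) (hyz : y ≠ z) :
    ¬ Collin G x y z := by
  rintro (h | h | h)
  · exact hy.not_between hG hxy.symm hyz h
  · exact hx.not_between hG hxy hxz h
  · exact hz.not_between hG hxz.symm hyz.symm h

/-- Twin leaves are collinear only with their common neighbour. -/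
theorem TwinLeaves.adj_of_collin (hG : G.IsTree) {x y z : V} (h : TwinLeaves G x y)
    (hx : z ≠ x) (hy : z ≠ y) (hc : Collin G x y z) : G.Adj x z := by
  have h₁ := h.dist_eq hG hx hy
  have h₂ := h.dist hG
  have := G.dist_comm (u := x) (v := y)
  have := G.dist_comm (u := z) (v := y)
  rw [← SimpleGraph.dist_eq_one_iff_adj]
  unfold Collin at hc
  omega

theorem TwinLeaves.collin_iff (hG : G.IsTree) {x y u v : V} (h : TwinLeaves G x y)
    (hux : u ≠ x) (huy : u ≠ y) (hvx : v ≠ x) (hvy : v ≠ y) :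
    Collin G u v x ↔ Collin G u v y := by
  have h₁ := h.dist_eq hG hux huy
  have h₂ := h.dist_eq hG hvx hvy
  unfold Collin
  rw [G.dist_comm (u := u) (v := x), G.dist_comm (u := v) (v := x), h₁, h₂,
    G.dist_comm (u := u) (v := y), G.dist_comm (u := v) (v := y)]

end Leaves

section Branches

/-- Each vertex with at least three neighbours has at most one neighbour that is not a leaf. -/
def IsBroomLike (G : SimpleGraph V) : Prop :=
  ∀ m w₁ w₂ w₃, G.Adj m w₁ → G.Adj m w₂ → G.Adj m w₃ → w₁ ≠ w₂ → w₁ ≠ w₃ → w₂ ≠ w₃ →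
    LeafAt G w₁ m ∨ LeafAt G w₂ m

/-- Three non-collinear vertices of a tree lie in distinct branches at some vertex. -/
theorem exists_median [Finite V] (hG : G.IsTree) {u v p : V} (h : ¬ Collin G u v p) :
    ∃ m w₁ w₂ w₃, G.Adj m w₁ ∧ G.Adj m w₂ ∧ G.Adj m w₃ ∧ w₁ ≠ w₂ ∧ w₁ ≠ w₃ ∧ w₂ ≠ w₃ ∧
      G.dist w₁ u < G.dist m u ∧ G.dist w₂ v < G.dist m v ∧ G.dist w₃ p < G.dist m p := by
  have : Nonempty V := ⟨u⟩
  obtain ⟨m, hm⟩ := Finite.exists_min fun m => G.dist m u + G.dist m v + G.dist m p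
  have huv : ∀ w, G.Adj m w → G.dist w u < G.dist m u → G.dist w v < G.dist m v → False := by
    intro w hw h₁ h₂
    have := hm w
    have := dist_step hG hw u
    have := dist_step hG hw v
    have := dist_step hG hw p
    omega
  have hup : ∀ w, G.Adj m w → G.dist w u < G.dist m u → G.dist w p < G.dist m p → False := by
    intro w hw h₁ h₂
    have := hm w
    have := dist_step hG hw u
    have := dist_step hG hw v
    have := dist_step hG hw p
    omega
  have hvp : ∀ w, G.Adj m w → G.dist w v < G.dist m v → G.dist w p < G.dist m p → False := by
    intro w hw h₁ h₂
    have := hm w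
    have := dist_step hG hw u
    have := dist_step hG hw v
    have := dist_step hG hw p
    omega
  have h₁ : G.dist u m + G.dist m v = G.dist u v :=
    (between_or_exists_closer hG v m _ u rfl).resolve_right
      fun ⟨w, hw, a, b⟩ => huv w hw a b
  have h₂ : G.dist u m + G.dist m p = G.dist u p :=
    (between_or_exists_closer hG p m _ u rfl).resolve_right
      fun ⟨w, hw, a, b⟩ => hup w hw a b
  have h₃ : G.dist v m + G.dist m p = G.dist v p :=
    (between_or_exists_closer hG p m _ v rfl).resolve_right
      fun ⟨w, hw, a, b⟩ => hvp w hw a b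
  have hmu : m ≠ u := by
    rintro rfl
    exact h (Or.inr (Or.inl h₃))
  have hmv : m ≠ v := by
    rintro rfl
    exact h (Or.inl h₂)
  have hmp : m ≠ p := by
    rintro rfl
    rw [G.dist_comm (u := v)] at h₃
    exact h (Or.inr (Or.inr (by rw [G.dist_comm (u := m) (v := v)]; rwa [G.dist_comm (u := v)])))
  obtain ⟨w₁, a₁, d₁⟩ := exists_adj_dist hG.connected hmu
  obtain ⟨w₂, a₂, d₂⟩ := exists_adj_dist hG.connected hmv
  obtain ⟨w₃, a₃, d₃⟩ := exists_adj_dist hG.connected hmp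
  refine ⟨m, w₁, w₂, w₃, a₁, a₂, a₃, ?_, ?_, ?_, by omega, by omega, by omega⟩
  · rintro rfl; exact huv _ a₁ (by omega) (by omega)
  · rintro rfl; exact hup _ a₁ (by omega) (by omega)
  · rintro rfl; exact hvp _ a₂ (by omega) (by omega)

theorem LeafAt.eq_of_closer (hG : G.IsTree) {w m u : V} (h : LeafAt G w m)
    (hd : G.dist w u < G.dist m u) : w = u := by
  by_contra hne
  have := h.dist hG hne
  omega

theorem IsBroomLike.exists_twins [Finite V] (hB : IsBroomLike G) (hG : G.IsTree) {u v p : V}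
    (h : ¬ Collin G u v p) : TwinLeaves G u v ∨ TwinLeaves G u p ∨ TwinLeaves G v p := by
  obtain ⟨m, w₁, w₂, w₃, a₁, a₂, a₃, n₁, n₂, n₃, d₁, d₂, d₃⟩ := exists_median hG h
  have e₁ : LeafAt G w₁ m → w₁ = u := fun hw => hw.eq_of_closer hG d₁
  have e₂ : LeafAt G w₂ m → w₂ = v := fun hw => hw.eq_of_closer hG d₂
  have e₃ : LeafAt G w₃ m → w₃ = p := fun hw => hw.eq_of_closer hG d₃
  have c₁ := hB m w₁ w₂ w₃ a₁ a₂ a₃ n₁ n₂ n₃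
  have c₂ := hB m w₁ w₃ w₂ a₁ a₃ a₂ n₂ n₁ n₃.symm
  have c₃ := hB m w₂ w₃ w₁ a₂ a₃ a₁ n₃ n₁.symm n₂.symm
  by_cases l₁ : LeafAt G w₁ m
  · obtain rfl := e₁ l₁
    rcases c₃ with l | l
    · obtain rfl := e₂ l
      exact Or.inl ⟨n₁, m, l₁, l⟩
    · obtain rfl := e₃ l
      exact Or.inr (Or.inl ⟨n₂, m, l₁, l⟩)
  · have l₂ := c₁.resolve_left l₁
    have l₃ := c₂.resolve_left l₁
    obtain rfl := e₂ l₂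
    obtain rfl := e₃ l₃
    exact Or.inr (Or.inr ⟨n₃, m, l₂, l₃⟩)

end Branches

section Lines

/-- `v` is neither a leaf nor a neighbour of `x`. -/
def Far (G : SimpleGraph V) (x v : V) : Prop := ¬ G.Adj x v ∧ ∀ d, ¬ LeafAt G v d

theorem LeafAt.exists_far (hG : G.IsTree) (hstar : ¬ ∃ v : V, ∀ w : V, w ≠ v → G.Adj v w)
    {x c : V} (h : LeafAt G x c) : ∃ v, Far G x v := by
  by_contra hno
  refine hstar ⟨c, fun z hz => ?_⟩
  obtain ⟨z', ha, hd⟩ := exists_adj_dist hG.connected hz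
  suffices z' = c from this ▸ ha.symm
  by_contra hne
  refine hno ⟨z', fun hxz => hne (h.2 z' hxz), fun d hl => ?_⟩
  have := hl.dist hG hne
  rw [← hl.2 z ha.symm] at this
  omega

theorem Far.ne {x c v : V} (h : Far G x v) (hx : LeafAt G x c) : x ≠ v := by
  rintro rfl
  exact h.2 c hx

theorem TwinLeaves.ne_of_not_leaf {x y v : V} (h : TwinLeaves G x y) (hv : ∀ d, ¬ LeafAt G v d) :
    v ≠ x := by
  rintro rfl
  obtain ⟨-, c, hx, -⟩ := h
  exact hv c hx

theorem TwinLeaves.not_collin_far (hG : G.IsTree) {x y v : V} (h : TwinLeaves G x y)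
    (hv : Far G x v) : ¬ Collin G x y v := fun hc =>
  hv.1 (h.adj_of_collin hG (h.ne_of_not_leaf hv.2) (h.symm.ne_of_not_leaf hv.2) hc)

theorem TwinLeaves.not_mem_redLine (hG : G.IsTree) {x y v : V} (h : TwinLeaves G x y)
    (hv : Far G x v) : y ∉ treeRedLine G x v := by
  rw [mem_redLine]
  exact fun hc => h.not_collin_far hG hv (Collin.swap_right hc)

theorem mem_redLine_of_mem_twinLeaves (hG : G.IsTree) {x y z : V} (hx : x ∈ twinLeaves G)
    (hy : y ∈ twinLeaves G) (hz : z ∈ twinLeaves G) (hyz : y ≠ z) (h : x ∈ treeRedLine G y z) :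
    x = y ∨ x = z := by
  rw [mem_twinLeaves hG] at hx hy hz
  obtain ⟨-, -, cx, hx, -⟩ := hx
  obtain ⟨-, -, cy, hy, -⟩ := hy
  obtain ⟨-, -, cz, hz, -⟩ := hz
  by_contra hne
  push Not at hne
  exact not_collin_of_leaves hG hy hz hx hyz hne.1.symm hne.2.symm (mem_redLine.1 h)

theorem TwinLeaves.mem_left (hG : G.IsTree) {x y : V} (h : TwinLeaves G x y) :
    x ∈ twinLeaves G := (mem_twinLeaves hG).2 ⟨y, h⟩

theorem redLine_pair_ne_univ (hG : G.IsTree) {v : V → V} (hv : ∀ x ∈ twinLeaves G, Far G x (v x))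
    {y z : V} (hy : y ∈ twinLeaves G) (hz : z ∈ twinLeaves G) (hyz : y ≠ z) :
    treeRedLine G y z ≠ Set.univ := by
  intro h
  obtain ⟨y', hy'⟩ := (mem_twinLeaves hG).1 hy
  rcases mem_redLine_of_mem_twinLeaves hG (hy'.symm.mem_left hG) hy hz hyz
    (h ▸ Set.mem_univ y') with rfl | rfl
  · exact hy'.1 rfl
  · exact hy'.not_collin_far hG (hv y hy) (mem_redLine.1 (h ▸ Set.mem_univ (v y)))

theorem redLine_far_ne_univ (hG : G.IsTree) {x v : V} (hx : x ∈ twinLeaves G) (hv : Far G x v) :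
    treeRedLine G x v ≠ Set.univ := by
  intro h
  obtain ⟨y, hy⟩ := (mem_twinLeaves hG).1 hx
  exact hy.not_mem_redLine hG hv (h ▸ Set.mem_univ y)

theorem redLine_far_ne_pair (hG : G.IsTree) {x v y z : V} (hx : x ∈ twinLeaves G)
    (hv : Far G x v) (hy : y ∈ twinLeaves G) (hz : z ∈ twinLeaves G) (hyz : y ≠ z) :
    treeRedLine G x v ≠ treeRedLine G y z := by
  intro h
  wlog hxy : x = y generalizing y z
  · rcases mem_redLine_of_mem_twinLeaves hG hx hy hz hyz (h ▸ left_mem_redLine x v) with rfl | rfl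
    · exact hxy rfl
    · exact this hz hy hyz.symm (h.trans (redLine_comm _ _)) rfl
  subst hxy
  have hzl : z ∈ treeRedLine G x v := h ▸ right_mem_redLine x z
  obtain ⟨z', hz'⟩ := (mem_twinLeaves hG).1 hz
  by_cases hzx : z' = x
  · subst hzx
    exact hz'.symm.not_mem_redLine hG hv hzl
  have hz'l : z' ∈ treeRedLine G x v := mem_redLine.2 <|
    (hz'.collin_iff hG hyz (Ne.symm hzx) (hz'.ne_of_not_leaf hv.2)
      (hz'.symm.ne_of_not_leaf hv.2)).1 (mem_redLine.1 hzl)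
  rcases mem_redLine_of_mem_twinLeaves hG (hz'.symm.mem_left hG) hx hz hyz (h ▸ hz'l) with h' | h'
  · exact hzx h'
  · exact hz'.1 h'.symm

theorem redLine_far_injOn (hG : G.IsTree) {v : V → V} (hv : ∀ x ∈ twinLeaves G, Far G x (v x)) :
    Set.InjOn (fun x => treeRedLine G x (v x)) (twinLeaves G) := by
  intro x hx y hy h
  simp only at h
  by_contra hne
  have hyl : y ∈ treeRedLine G x (v x) := h ▸ left_mem_redLine y (v y)
  obtain ⟨y', hy'⟩ := (mem_twinLeaves hG).1 hy
  by_cases hyx : y' = x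
  · subst hyx
    exact hy'.symm.not_mem_redLine hG (hv _ hx) hyl
  · have hy'l : y' ∈ treeRedLine G x (v x) := mem_redLine.2 <|
      (hy'.collin_iff hG hne (Ne.symm hyx) (hy'.ne_of_not_leaf (hv x hx).2)
        (hy'.symm.ne_of_not_leaf (hv x hx).2)).1 (mem_redLine.1 hyl)
    exact hy'.not_mem_redLine hG (hv y hy) (h ▸ hy'l)

/-- The red lines generated by pairs of twin leaves. -/
def pairLines (G : SimpleGraph V) : Set (Set V) :=
  {L | ∃ y z, y ∈ twinLeaves G ∧ z ∈ twinLeaves G ∧ y ≠ z ∧ L = treeRedLine G y z}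

/-- The lines that are present in the system of every tree that is not a star. -/
def basicLines (G : SimpleGraph V) (v : V → V) : Set (Set V) :=
  insert Set.univ (pairLines G ∪ (fun x => treeRedLine G x (v x)) '' twinLeaves G)

theorem redLine_inter_twinLeaves (hG : G.IsTree) {y z : V} (hy : y ∈ twinLeaves G)
    (hz : z ∈ twinLeaves G) (hyz : y ≠ z) : treeRedLine G y z ∩ twinLeaves G = {y, z} := by
  ext x
  simp only [Set.mem_inter_iff, Set.mem_insert_iff, Set.mem_singleton_iff]
  constructor
  · rintro ⟨h, hx⟩
    exact mem_redLine_of_mem_twinLeaves hG hx hy hz hyz h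
  · rintro (rfl | rfl)
    · exact ⟨left_mem_redLine _ _, hy⟩
    · exact ⟨right_mem_redLine _ _, hz⟩

theorem ncard_pairLines [Finite V] (hG : G.IsTree) :
    (pairLines G).ncard = (twinLeaves G).ncard.choose 2 := by
  classical
  have hinj : Set.InjOn (fun L => L ∩ twinLeaves G) (pairLines G) := by
    rintro _ ⟨y, z, hy, hz, hyz, rfl⟩ _ ⟨y', z', hy', hz', hyz', rfl⟩ h
    simp only [redLine_inter_twinLeaves hG hy hz hyz, redLine_inter_twinLeaves hG hy' hz' hyz'] at h
    rcases Set.pair_eq_pair_iff.1 h with ⟨rfl, rfl⟩ | ⟨rfl, rfl⟩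
    · rfl
    · exact redLine_comm _ _
  rw [← hinj.ncard_image]
  set A := (Set.toFinite (twinLeaves G)).toFinset with hA
  have himg : (fun L => L ∩ twinLeaves G) '' pairLines G =
      (fun s : Finset V => (s : Set V)) '' (A.powersetCard 2 : Set (Finset V)) := by
    ext s
    simp only [Set.mem_image, Finset.mem_coe, Finset.mem_powersetCard, Finset.card_eq_two]
    constructor
    · rintro ⟨_, ⟨y, z, hy, hz, hyz, rfl⟩, rfl⟩
      refine ⟨{y, z}, ⟨?_, y, z, hyz, rfl⟩, ?_⟩
      · intro x
        simp only [Finset.mem_insert, Finset.mem_singleton, hA, Set.Finite.mem_toFinset]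
        rintro (rfl | rfl) <;> assumption
      · rw [redLine_inter_twinLeaves hG hy hz hyz]; simp
    · rintro ⟨_, ⟨hs, y, z, hyz, rfl⟩, rfl⟩
      have hy : y ∈ twinLeaves G := by simpa [hA] using hs (Finset.mem_insert_self y {z})
      have hz : z ∈ twinLeaves G := by
        simpa [hA] using hs (Finset.mem_insert_of_mem (Finset.mem_singleton_self z))
      exact ⟨_, ⟨y, z, hy, hz, hyz, rfl⟩, by rw [redLine_inter_twinLeaves hG hy hz hyz]; simp⟩
  rw [himg, Set.ncard_image_of_injective _ Finset.coe_injective, Set.ncard_coe_finset,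
    Finset.card_powersetCard, hA, Set.ncard_eq_toFinset_card]

theorem ncard_basicLines [Finite V] (hG : G.IsTree) {v : V → V}
    (hv : ∀ x ∈ twinLeaves G, Far G x (v x)) :
    (basicLines G v).ncard = (twinLeaves G).ncard.choose 2 + (twinLeaves G).ncard + 1 := by
  rw [basicLines, Set.ncard_insert_of_notMem, Set.ncard_union_eq, ncard_pairLines hG,
    (redLine_far_injOn hG hv).ncard_image]
  · rw [Set.disjoint_left]
    rintro _ ⟨y, z, hy, hz, hyz, rfl⟩ ⟨x, hx, h⟩
    exact redLine_far_ne_pair hG hx (hv x hx) hy hz hyz h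
  · rintro (⟨y, z, hy, hz, hyz, h⟩ | ⟨x, hx, h⟩)
    · exact redLine_pair_ne_univ hG hv hy hz hyz h.symm
    · exact redLine_far_ne_univ hG hx (hv x hx) h

theorem redLine_of_adj (hG : G.IsTree) {u v : V} (h : G.Adj u v) :
    treeRedLine G u v = Set.univ :=
  Set.eq_univ_of_forall fun p => mem_redLine.2 (collin_of_adj hG h p)

theorem basicLines_subset (hG : G.IsTree) (hstar : ¬ ∃ v : V, ∀ w : V, w ≠ v → G.Adj v w)
    {v : V → V} (hv : ∀ x ∈ twinLeaves G, Far G x (v x)) : basicLines G v ⊆ treeRedLines G := by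
  rintro _ (rfl | ⟨y, z, -, -, hyz, rfl⟩ | ⟨x, hx, rfl⟩)
  · obtain ⟨u⟩ := hG.connected.nonempty
    push Not at hstar
    obtain ⟨w, hw, -⟩ := hstar u
    obtain ⟨c, hc, -⟩ := exists_adj_dist hG.connected hw
    exact ⟨w, c, hc.ne, (redLine_of_adj hG hc).symm⟩
  · exact ⟨y, z, hyz, rfl⟩
  · obtain ⟨y, -, c, hc, -⟩ := (mem_twinLeaves hG).1 hx
    exact ⟨x, v x, (hv x hx).ne hc, rfl⟩

/-- In a broom-like tree, the line through a twin leaf `x` and a vertex that is neither a twin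
leaf nor its neighbour misses exactly the twins of `x`. -/
theorem IsBroomLike.redLine_eq [Finite V] (hB : IsBroomLike G) (hG : G.IsTree) {x v : V}
    (hv : v ∉ twinLeaves G) (hxv : ¬ G.Adj x v) :
    treeRedLine G x v = {p | ¬ TwinLeaves G x p} := by
  ext p
  rw [mem_redLine, Set.mem_ofPred_eq]
  constructor
  · intro hc ht
    have h₁ : v ≠ x := by rintro rfl; exact hv (ht.mem_left hG)
    have h₂ : v ≠ p := by rintro rfl; exact hv (ht.symm.mem_left hG)
    exact hxv (ht.adj_of_collin hG h₁ h₂ (Collin.swap_right hc))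
  · intro ht
    by_contra hc
    rcases hB.exists_twins hG hc with h | h | h
    · exact hv (h.symm.mem_left hG)
    · exact ht h
    · exact hv (h.mem_left hG)

theorem not_mem_twinLeaves_of_not_leaf (hG : G.IsTree) {v : V} (h : ∀ d, ¬ LeafAt G v d) :
    v ∉ twinLeaves G := fun hv => by
  obtain ⟨-, -, c, hc, -⟩ := (mem_twinLeaves hG).1 hv
  exact h c hc

theorem IsBroomLike.subset_basicLines [Finite V] (hB : IsBroomLike G) (hG : G.IsTree)
    {f : V → V} (hf : ∀ x ∈ twinLeaves G, Far G x (f x)) : treeRedLines G ⊆ basicLines G f := by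
  have key : ∀ x ∈ twinLeaves G, ∀ v ∉ twinLeaves G, treeRedLine G x v ∈ basicLines G f := by
    intro x hx v hv
    by_cases ha : G.Adj x v
    · exact Or.inl (redLine_of_adj hG ha)
    · refine Or.inr (Or.inr ⟨x, hx, ?_⟩)
      simp only
      rw [hB.redLine_eq hG hv ha, hB.redLine_eq hG
        (not_mem_twinLeaves_of_not_leaf hG (hf x hx).2) (hf x hx).1]
  rintro _ ⟨u, v, huv, rfl⟩
  by_cases hu : u ∈ twinLeaves G
  · by_cases hv : v ∈ twinLeaves G
    · exact Or.inr (Or.inl ⟨u, v, hu, hv, huv, rfl⟩)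
    · exact key u hu v hv
  · by_cases hv : v ∈ twinLeaves G
    · rw [redLine_comm]
      exact key v hv u hu
    · refine Or.inl (Set.eq_univ_of_forall fun p => mem_redLine.2 ?_)
      by_contra hc
      rcases hB.exists_twins hG hc with h | h | h
      · exact hu (h.mem_left hG)
      · exact hu (h.mem_left hG)
      · exact hv (h.mem_left hG)

theorem isBroomLike_of_subset (hG : G.IsTree) {f : V → V}
    (hf : ∀ x ∈ twinLeaves G, Far G x (f x)) (h : treeRedLines G ⊆ basicLines G f) :
    IsBroomLike G := by
  intro m w₁ w₂ w₃ a₁ a₂ a₃ n₁ n₂ n₃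
  by_contra hno
  push Not at hno
  have hl₁ : ∀ d, ¬ LeafAt G w₁ d := fun d hd => hno.1 (by rwa [hd.2 m a₁.symm])
  have hl₂ : ∀ d, ¬ LeafAt G w₂ d := fun d hd => hno.2 (by rwa [hd.2 m a₂.symm])
  have htwin : ∀ {x y}, TwinLeaves G x y → x ∈ treeRedLine G w₁ w₂ → y ∈ treeRedLine G w₁ w₂ := by
    intro x y hxy hx
    rw [mem_redLine] at hx ⊢
    exact (hxy.collin_iff hG (hxy.ne_of_not_leaf hl₁) (hxy.symm.ne_of_not_leaf hl₁)
      (hxy.ne_of_not_leaf hl₂) (hxy.symm.ne_of_not_leaf hl₂)).1 hx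
  have hd : ∀ {w w'}, G.Adj m w → G.Adj m w' → w ≠ w' → G.dist w w' = 2 := by
    intro w w' hw hw' hne
    have e₁ := SimpleGraph.dist_eq_one_iff_adj.2 hw'
    rcases dist_step hG hw w' with h' | h'
    · exact absurd (hG.connected.dist_eq_zero_iff.1 (by omega)) hne
    · omega
  rcases h ⟨w₁, w₂, n₁, rfl⟩ with h' | ⟨y, z, hy, hz, hyz, h'⟩ | ⟨x, hx, h'⟩
  · have hc : Collin G w₁ w₂ w₃ := mem_redLine.1 (h' ▸ Set.mem_univ w₃)
    have := hd a₁ a₂ n₁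
    have := hd a₁ a₃ n₂
    have := hd a₂ a₃ n₃
    have := hd a₂ a₁ n₁.symm
    have := hd a₃ a₂ n₃.symm
    unfold Collin at hc
    omega
  · obtain ⟨y', hy'⟩ := (mem_twinLeaves hG).1 hy
    have hy'l := htwin hy' (h' ▸ left_mem_redLine y z)
    rcases mem_redLine_of_mem_twinLeaves hG (hy'.symm.mem_left hG) hy hz hyz (h' ▸ hy'l)
      with rfl | rfl
    · exact hy'.1 rfl
    · have b₁ := hy'.adj_of_collin hG (hy'.ne_of_not_leaf hl₁) (hy'.symm.ne_of_not_leaf hl₁)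
        (mem_redLine.1 (h' ▸ left_mem_redLine w₁ w₂))
      have b₂ := hy'.adj_of_collin hG (hy'.ne_of_not_leaf hl₂) (hy'.symm.ne_of_not_leaf hl₂)
        (mem_redLine.1 (h' ▸ right_mem_redLine w₁ w₂))
      obtain ⟨-, c, hc, -⟩ := hy'
      exact n₁ ((hc.2 _ b₁).trans (hc.2 _ b₂).symm)
  · simp only at h'
    obtain ⟨y, hy⟩ := (mem_twinLeaves hG).1 hx
    exact hy.not_mem_redLine hG (hf x hx) (h' ▸ htwin hy (h' ▸ left_mem_redLine x (f x)))

theorem treeNumRed_eq_iff [Finite V] (hG : G.IsTree)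
    (hstar : ¬ ∃ v : V, ∀ w : V, w ≠ v → G.Adj v w) :
    treeNumRed G = (twinLeaves G).ncard.choose 2 + (twinLeaves G).ncard + 1 ↔ IsBroomLike G := by
  have hex : ∀ x, ∃ v, x ∈ twinLeaves G → Far G x v := by
    intro x
    by_cases hx : x ∈ twinLeaves G
    · obtain ⟨-, -, c, hc, -⟩ := (mem_twinLeaves hG).1 hx
      obtain ⟨v, hv⟩ := hc.exists_far hG hstar
      exact ⟨v, fun _ => hv⟩
    · exact ⟨x, fun h => absurd h hx⟩
  choose f hf using hex
  have hsub := basicLines_subset hG hstar hf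
  rw [treeNumRed, ← ncard_basicLines hG hf]
  constructor
  · intro h
    exact isBroomLike_of_subset hG hf (Set.eq_of_subset_of_ncard_le hsub h.le).ge
  · intro hB
    rw [(hB.subset_basicLines hG hf).antisymm hsub]

end Lines

section Levels

/-- The number of vertices at each level of a broom of length `D` with `a` vertices at the first
level and `b` vertices at the last. -/
def levelCard (D a b k : ℕ) : ℕ :=
  if k = 0 then a else if k < D then 1 else if k = D then b else 0

/-- The vertices of `G` are arranged in levels `0, …, D` with adjacency being the relation of
having consecutive levels; there are `a` vertices at level `0`, `b` at level `D` and one at each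
level in between. -/
def HasBroomLevels (G : SimpleGraph V) (D a b : ℕ) : Prop :=
  ∃ l : V → ℕ, (∀ x y, G.Adj x y ↔ l x + 1 = l y ∨ l y + 1 = l x) ∧
    ∀ k, Nat.card {x // l x = k} = levelCard D a b k

theorem HasBroomLevels.nonempty_iso {W : Type*} [Finite V] [Finite W] {H : SimpleGraph W}
    {D a b : ℕ} (hG : HasBroomLevels G D a b) (hH : HasBroomLevels H D a b) :
    Nonempty (G ≃g H) := by
  obtain ⟨l, hl, hc⟩ := hG
  obtain ⟨l', hl', hc'⟩ := hH
  let e : ∀ k, {x // l x = k} ≃ {x // l' x = k} := fun k =>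
    (Finite.card_eq.1 ((hc k).trans (hc' k).symm)).some
  have he : ∀ x, l' (Equiv.ofFiberEquiv e x) = l x := Equiv.ofFiberEquiv_map e
  refine ⟨⟨Equiv.ofFiberEquiv e, fun {x y} => ?_⟩⟩
  rw [hl, hl', he, he]

theorem HasBroomLevels.of_iso {W : Type*} {H : SimpleGraph W} {D a b : ℕ}
    (hH : HasBroomLevels H D a b) (φ : G ≃g H) : HasBroomLevels G D a b := by
  obtain ⟨l, hl, hc⟩ := hH
  refine ⟨l ∘ φ, fun x y => by rw [← φ.map_adj_iff, hl]; rfl, fun k => ?_⟩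
  rw [← hc k]
  exact Nat.card_congr (φ.toEquiv.subtypeEquiv fun x => Iff.rfl)

theorem HasBroomLevels.isBroomLike [Finite V] {D a b : ℕ} (h : HasBroomLevels G D a b)
    (hD : 2 ≤ D) : IsBroomLike G := by
  obtain ⟨l, hl, hc⟩ := h
  have huniq : ∀ x y, l x = l y → 0 < l x → l x < D → x = y := by
    intro x y hxy h₀ h₁
    have hcard : Nat.card {z // l z = l x} = 1 := by
      rw [hc, levelCard, if_neg (by omega), if_pos h₁]
    have := (Nat.card_eq_one_iff_unique.1 hcard).1
    exact congrArg Subtype.val (Subsingleton.elim (⟨x, rfl⟩ : {z // l z = l x}) ⟨y, hxy.symm⟩)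
  have hle : ∀ x, l x ≤ D := by
    intro x
    by_contra hx
    have hcard : Nat.card {z // l z = l x} = 0 := by
      rw [hc, levelCard, if_neg (by omega), if_neg (by omega), if_neg (by omega)]
    rcases Nat.card_eq_zero.1 hcard with h | h
    · exact h.false ⟨x, rfl⟩
    · exact h.not_finite inferInstance
  have hleaf : ∀ x m, G.Adj m x → l x = 0 ∨ l x = D → LeafAt G x m := by
    intro x m hxm hx
    refine ⟨hxm.symm, fun z hz => huniq z m ?_ ?_ ?_⟩ <;>
    · rw [hl] at hz hxm
      have := hle z
      have := hle m
      omega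
  intro m w₁ w₂ w₃ a₁ a₂ a₃ n₁ n₂ n₃
  by_contra hno
  push Not at hno
  have h₁ : ¬ (l w₁ = 0 ∨ l w₁ = D) := fun h => hno.1 (hleaf _ _ a₁ h)
  have h₂ : ¬ (l w₂ = 0 ∨ l w₂ = D) := fun h => hno.2 (hleaf _ _ a₂ h)
  have := hle w₁
  have := hle w₂
  rw [hl] at a₁ a₂ a₃
  have hw : l w₁ ≠ l w₂ := fun h => n₁ (huniq _ _ h (by omega) (by omega))
  have h₁₃ : l w₁ ≠ l w₃ := fun h => n₂ (huniq _ _ h (by omega) (by omega))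
  have h₂₃ : l w₂ ≠ l w₃ := fun h => n₃ (huniq _ _ h (by omega) (by omega))
  omega

theorem card_fin_level {n lo hi k : ℕ} (l : ℕ → ℕ)
    (h : ∀ j, (j < n ∧ l j = k) ↔ (lo ≤ j ∧ j < hi)) :
    Nat.card {i : Fin n // l i = k} = hi - lo := by
  rw [← Nat.card_Ico, ← Nat.card_eq_finsetCard]
  refine Nat.card_congr ⟨fun i => ⟨i.1, ?_⟩, fun j => ⟨⟨j.1, ?_⟩, ?_⟩, fun _ => rfl, fun _ => rfl⟩
  · exact Finset.mem_Ico.2 ((h i.1).1 ⟨i.1.2, i.2⟩)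
  · exact ((h j.1).2 (Finset.mem_Ico.1 j.2)).1
  · exact ((h j.1).2 (Finset.mem_Ico.1 j.2)).2

theorem hasBroomLevels_pathGraph {D : ℕ} (hD : 1 ≤ D) :
    HasBroomLevels (SimpleGraph.pathGraph (D + 1)) D 1 1 := by
  refine ⟨fun i => i, fun x y => by rw [SimpleGraph.pathGraph_adj], fun k => ?_⟩
  rw [levelCard]
  split_ifs with h₁ h₂ h₃
  · exact card_fin_level (lo := 0) (hi := 1) (fun i => i) fun j => by omega
  · rw [card_fin_level (lo := k) (hi := k + 1) (fun i => i) fun j => by omega]; omega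
  · rw [card_fin_level (lo := k) (hi := k + 1) (fun i => i) fun j => by omega]; omega
  · exact card_fin_level (lo := 0) (hi := 0) (fun i => i) fun j => by omega

theorem hasBroomLevels_Spq {p q : ℕ} (hq : 1 ≤ q) : HasBroomLevels (Spq p q) q 1 p := by
  refine ⟨fun i => min (i : ℕ) q, fun x y => ?_, fun k => ?_⟩
  · have := x.2
    have := y.2
    rw [Spq, SimpleGraph.fromRel_adj, ne_eq, Fin.ext_iff]
    dsimp only
    omega
  rw [levelCard]
  split_ifs with h₁ h₂ h₃
  · exact card_fin_level (lo := 0) (hi := 1) (fun i => min i q) fun j => by omega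
  · rw [card_fin_level (lo := k) (hi := k + 1) (fun i => min i q) fun j => by omega]; omega
  · rw [card_fin_level (lo := q) (hi := q + p) (fun i => min i q) fun j => by omega]; omega
  · exact card_fin_level (lo := 0) (hi := 0) (fun i => min i q) fun j => by omega

theorem hasBroomLevels_DoubleBroom {p₁ p₂ q : ℕ} (hq : 1 ≤ q) :
    HasBroomLevels (DoubleBroom p₁ p₂ q) (q + 1) p₁ p₂ := by
  let l : ℕ → ℕ := fun i => if i < q then i + 1 else if i < q + p₁ then 0 else q + 1
  have hl : ∀ i, (i < q ∧ l i = i + 1) ∨ (q ≤ i ∧ i < q + p₁ ∧ l i = 0) ∨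
      (q + p₁ ≤ i ∧ l i = q + 1) := by
    intro i
    simp only [l]
    split_ifs <;> omega
  refine ⟨fun i => l i, fun x y => ?_, fun k => ?_⟩
  · have := x.2
    have := y.2
    have := hl x
    have := hl y
    rw [DoubleBroom, SimpleGraph.fromRel_adj, ne_eq, Fin.ext_iff]
    dsimp only
    omega
  rw [levelCard]
  split_ifs with h₁ h₂ h₃
  · rw [card_fin_level (lo := q) (hi := q + p₁) l fun j => by have := hl j; omega]; omega
  · rw [card_fin_level (lo := k - 1) (hi := k) l fun j => by have := hl j; omega]; omega
  · rw [card_fin_level (lo := q + p₁) (hi := q + p₁ + p₂) l fun j => by have := hl j; omega]; omega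
  · exact card_fin_level (lo := 0) (hi := 0) l fun j => by have := hl j; omega

end Levels

section Structure

/-- The leaf `e` together with its twins. -/
def twinClass (G : SimpleGraph V) (e : V) : Set V := {x | x = e ∨ TwinLeaves G e x}

/-- An end of a diameter of a tree is a leaf. -/
theorem exists_leafAt_of_dist_max (hG : G.IsTree) {e f : V} (hef : e ≠ f)
    (hmax : ∀ x y, G.dist x y ≤ G.dist e f) : ∃ c, LeafAt G e c := by
  obtain ⟨c, hc, hd⟩ := exists_adj_dist hG.connected hef
  refine ⟨c, hc, fun z hz => closer_neighbor_unique hG hz hc (z := f) ?_ (by omega)⟩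
  have := hmax z f
  have := dist_step hG hz f
  omega

theorem exists_dist_eq (hG : G.Connected) (e f : V) :
    ∀ i ≤ G.dist e f, ∃ p, G.dist e p = i ∧ i + G.dist p f = G.dist e f := by
  intro i
  induction i with
  | zero => exact fun _ => ⟨e, by simp, by simp⟩
  | succ i ih =>
    intro hi
    obtain ⟨p, h₁, h₂⟩ := ih (by omega)
    have hne : p ≠ f := by rintro rfl; simp at h₂; omega
    obtain ⟨w, hw, hd⟩ := exists_adj_dist hG hne
    have h₃ := hG.dist_triangle (u := e) (v := p) (w := w)
    have h₄ := hG.dist_triangle (u := e) (v := w) (w := f)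
    rw [SimpleGraph.dist_eq_one_iff_adj.2 hw] at h₃
    exact ⟨w, by omega, by omega⟩

open Classical in
theorem IsBroomLike.hasBroomLevels [Finite V] (hB : IsBroomLike G) (hG : G.IsTree) {e f : V}
    (hD : 3 ≤ G.dist e f) (hmax : ∀ x y, G.dist x y ≤ G.dist e f) :
    HasBroomLevels G (G.dist e f) (twinClass G e).ncard (twinClass G f).ncard := by
  have hef : e ≠ f := by rintro rfl; simp at hD
  obtain ⟨c, hc⟩ := exists_leafAt_of_dist_max hG hef hmax
  obtain ⟨d, hd⟩ := exists_leafAt_of_dist_max hG hef.symm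
    (by rw [G.dist_comm (u := f)]; exact hmax)
  have htef : ¬ TwinLeaves G e f := fun h => by have := h.dist hG; omega
  have hbetween : ∀ x, ¬ TwinLeaves G e x → 0 < G.dist e x → G.dist e x < G.dist e f →
      G.dist e x + G.dist x f = G.dist e f := by
    intro x hx h₀ h₁
    by_cases hcol : Collin G e f x
    · have := hmax x f
      have := G.dist_comm (u := e) (v := f)
      have := G.dist_comm (u := x) (v := f)
      unfold Collin at hcol
      omega
    · rcases hB.exists_twins hG hcol with h | h | h
      · exact absurd h htef
      · exact absurd h hx
      · have hex : e ≠ x := by rintro rfl; simp at h₀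
        have := h.dist_eq hG hef hex
        have := G.dist_comm (u := e) (v := f)
        have := G.dist_comm (u := e) (v := x)
        omega
  have hunique : ∀ x y, ¬ TwinLeaves G e x → ¬ TwinLeaves G e y → G.dist e x = G.dist e y →
      0 < G.dist e x → G.dist e x < G.dist e f → x = y := by
    intro x y hx hy hxy h₀ h₁
    have h₂ := hbetween x hx h₀ h₁
    by_contra hne
    have hex : e ≠ x := by rintro rfl; simp at h₀
    have hey : e ≠ y := by rintro rfl; rw [G.dist_self] at hxy; omega
    have hfx : x ≠ f := by rintro rfl; omega
    by_cases hcol : Collin G e x y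
    · have h₃ := hc.not_between hG hex hey
      have h₄ := hG.connected.pos_dist_of_ne hne
      have := G.dist_comm (u := x) (v := y)
      unfold Collin at hcol
      omega
    · rcases hB.exists_twins hG hcol with h | h | h
      · exact hx h
      · exact hy h
      · obtain ⟨-, b, hb, -⟩ := h
        exact hb.not_between hG hex.symm hfx h₂
  have hlast : ∀ x, G.dist e x = G.dist e f → x = f ∨ TwinLeaves G f x := by
    intro x hx
    by_cases hxf : x = f
    · exact Or.inl hxf
    right
    have hcol : ¬ Collin G e f x := by
      have h₁ := hG.connected.pos_dist_of_ne hxf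
      have := hmax f x
      have := G.dist_comm (u := x) (v := f)
      have := G.dist_comm (u := e) (v := f)
      unfold Collin
      omega
    rcases hB.exists_twins hG hcol with h | h | h
    · exact absurd h htef
    · have := h.dist hG; omega
    · exact h
  have htwin : ∀ x, TwinLeaves G e x → ∀ y, G.Adj x y → G.dist e y = 1 := by
    rintro x ⟨-, b, h₁, h₂⟩ y hy
    rw [h₂.2 y hy]
    exact SimpleGraph.dist_eq_one_iff_adj.2 h₁.1
  let l : V → ℕ := fun x => if TwinLeaves G e x then 0 else G.dist e x
  have hl : ∀ x, (TwinLeaves G e x ∧ l x = 0) ∨ (¬ TwinLeaves G e x ∧ l x = G.dist e x) := by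
    intro x
    simp only [l]
    split_ifs <;> tauto
  have hup : ∀ x y, l x + 1 = l y → G.Adj x y := by
    intro x y hxy
    have hy : ¬ TwinLeaves G e y ∧ l y = G.dist e y :=
      (hl y).resolve_left fun h => by omega
    rcases hl x with ⟨hx, hlx⟩ | ⟨hx, hlx⟩
    · have hey : G.Adj e y := SimpleGraph.dist_eq_one_iff_adj.1 (by omega)
      obtain ⟨-, b, h₁, h₂⟩ := hx
      rw [h₁.2 y hey]
      exact h₂.1
    · by_cases hex : e = x
      · subst hex
        rw [G.dist_self] at hlx
        exact SimpleGraph.dist_eq_one_iff_adj.1 (by omega)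
      have hpos := hG.connected.pos_dist_of_ne hex
      have hye : y ≠ e := by rintro rfl; rw [G.dist_self] at hy; omega
      obtain ⟨z, hz, hdz⟩ := exists_adj_dist hG.connected hye
      rw [G.dist_comm, G.dist_comm (u := y)] at hdz
      have hze : ¬ TwinLeaves G e z := fun h => by
        have := htwin z h y hz.symm
        omega
      have := hmax e y
      rw [hunique x z hx hze (by omega) hpos (by omega)]
      exact hz.symm
  refine ⟨l, fun x y => ⟨fun h => ?_, ?_⟩, fun k => ?_⟩
  · have hxy := dist_step hG h e
    rw [G.dist_comm, G.dist_comm (u := y)] at hxy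
    rcases hl x with ⟨hx, hlx⟩ | ⟨hx, hlx⟩
    · have := htwin x hx y h
      rcases hl y with ⟨hy, hly⟩ | ⟨hy, hly⟩
      · have := hy.dist hG; omega
      · omega
    · rcases hl y with ⟨hy, hly⟩ | ⟨hy, hly⟩
      · have := htwin y hy x h.symm
        omega
      · omega
  · rintro (h | h)
    · exact hup x y h
    · exact (hup y x h).symm
  · change Nat.card {x | l x = k} = _
    rw [Nat.card_coe_set_eq, levelCard]
    split_ifs with h₁ h₂ h₃
    · congr 1
      ext x
      simp only [twinClass, Set.mem_ofPred_eq]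
      rw [h₁]
      constructor
      · intro h
        rcases hl x with hx | hx
        · exact Or.inr hx.1
        · exact Or.inl (hG.connected.dist_eq_zero_iff.1 (by omega)).symm
      · rintro (rfl | h)
        · rcases hl x with hx | hx
          · exact hx.2
          · rw [hx.2, G.dist_self]
        · exact ((hl x).resolve_right fun h' => h'.1 h).2
    · rw [Set.ncard_eq_one]
      obtain ⟨p, hp, hpf⟩ := exists_dist_eq hG.connected e f k h₂.le
      have hep : e ≠ p := by rintro rfl; rw [G.dist_self] at hp; omega
      have hpf' : p ≠ f := by rintro rfl; omega
      have hpt : ¬ TwinLeaves G e p := by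
        rintro ⟨-, b, -, hb⟩
        exact hb.not_between hG hep.symm hpf' (by omega)
      refine ⟨p, Set.ext fun x => ?_⟩
      simp only [Set.mem_ofPred_eq, Set.mem_singleton_iff]
      constructor
      · intro h
        have hx := (hl x).resolve_left fun hx => by omega
        exact hunique x p hx.1 hpt (by omega) (by omega) (by omega)
      · rintro rfl
        exact ((hl x).resolve_left fun hx => hpt hx.1).2.trans hp
    · congr 1
      ext x
      simp only [twinClass, Set.mem_ofPred_eq]
      constructor
      · intro h
        have hx := (hl x).resolve_left fun hx => by omega
        exact hlast x (by omega)
      · intro h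
        have hx : G.dist e x = G.dist e f := by
          rcases h with rfl | h
          · rfl
          · have hex : e ≠ x := by
              rintro rfl
              exact htef h.symm
            rw [G.dist_comm, G.dist_comm (v := f)]
            exact (h.dist_eq hG hef hex).symm
        have hxt := (hl x).resolve_left fun hx => by have := hx.1.dist hG; omega
        omega
    · rw [Set.ncard_eq_zero, Set.eq_empty_iff_forall_notMem]
      intro x h
      have := hmax e x
      have := hl x
      rw [Set.mem_ofPred_eq] at h
      omega

theorem three_le_dist_of_max (hG : G.IsTree) (hstar : ¬ ∃ v : V, ∀ w : V, w ≠ v → G.Adj v w)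
    {e f : V} (hmax : ∀ x y, G.dist x y ≤ G.dist e f) : 3 ≤ G.dist e f := by
  by_contra hlt
  by_cases hef : e = f
  · subst hef
    refine hstar ⟨e, fun w hw => absurd (hG.connected.dist_eq_zero_iff.1 ?_) hw⟩
    have := hmax w e
    rw [G.dist_self] at this
    omega
  obtain ⟨c, hc⟩ := exists_leafAt_of_dist_max hG hef hmax
  refine hstar ⟨c, fun w hw => ?_⟩
  by_cases hwe : e = w
  · exact hwe ▸ hc.1.symm
  have h₁ := hc.dist hG hwe
  have h₂ := hmax e w
  have h₃ := hG.connected.pos_dist_of_ne hw.symm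
  exact SimpleGraph.dist_eq_one_iff_adj.1 (by omega)

theorem one_le_ncard_twinClass [Finite V] (e : V) : 1 ≤ (twinClass G e).ncard :=
  (Set.ncard_pos).2 ⟨e, Or.inl rfl⟩

theorem isBroomLike_iff [Fintype V] (hG : G.IsTree)
    (hpath : ¬ Nonempty (G ≃g SimpleGraph.pathGraph (Fintype.card V)))
    (hstar : ¬ ∃ v : V, ∀ w : V, w ≠ v → G.Adj v w) :
    IsBroomLike G ↔
      ((∃ p q : ℕ, 2 ≤ p ∧ 3 ≤ q ∧ Nonempty (G ≃g Spq p q)) ∨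
       (∃ p₁ p₂ q : ℕ, 2 ≤ p₁ ∧ 2 ≤ p₂ ∧ 2 ≤ q ∧ Nonempty (G ≃g DoubleBroom p₁ p₂ q))) := by
  constructor
  · intro hB
    have := hG.connected.nonempty
    obtain ⟨⟨e, f⟩, hm⟩ := Finite.exists_max fun p : V × V => G.dist p.1 p.2
    have hmax : ∀ x y, G.dist x y ≤ G.dist e f := fun x y => hm (x, y)
    have hD := three_le_dist_of_max hG hstar hmax
    have hmax' : ∀ x y, G.dist x y ≤ G.dist f e := by rwa [G.dist_comm (u := f)]
    have hef := hB.hasBroomLevels hG hD hmax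
    have hfe := hB.hasBroomLevels hG (by rwa [G.dist_comm]) hmax'
    rw [G.dist_comm] at hfe
    have h₁ := one_le_ncard_twinClass (G := G) e
    have h₂ := one_le_ncard_twinClass (G := G) f
    generalize (twinClass G e).ncard = a at *
    generalize (twinClass G f).ncard = b at *
    generalize G.dist e f = D at *
    by_cases ha : a = 1
    · subst ha
      by_cases hb : b = 1
      · subst hb
        obtain ⟨φ⟩ := hef.nonempty_iso (hasBroomLevels_pathGraph (D := D) (by omega))
        have hcard : Fintype.card V = D + 1 := by simpa using Fintype.card_congr φ.toEquiv
        rw [hcard] at hpath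
        exact absurd ⟨φ⟩ hpath
      · exact Or.inl ⟨b, D, by omega, hD, hef.nonempty_iso (hasBroomLevels_Spq (by omega))⟩
    · by_cases hb : b = 1
      · subst hb
        exact Or.inl ⟨a, D, by omega, hD, hfe.nonempty_iso (hasBroomLevels_Spq (by omega))⟩
      · obtain ⟨q, rfl⟩ : ∃ q, D = q + 1 := ⟨D - 1, by omega⟩
        exact Or.inr ⟨a, b, q, by omega, by omega, by omega,
          hef.nonempty_iso (hasBroomLevels_DoubleBroom (by omega))⟩
  · rintro (⟨p, q, -, hq, ⟨φ⟩⟩ | ⟨p₁, p₂, q, -, -, hq, ⟨φ⟩⟩)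
    · exact ((hasBroomLevels_Spq (by omega)).of_iso φ).isBroomLike (by omega)
    · exact ((hasBroomLevels_DoubleBroom (by omega)).of_iso φ).isBroomLike (by omega)

end Structure

end TreeLines

/-- For a tree `T` on `n` vertices that is neither a path nor a star,
`m_S(R) = C(a,2) + a + 1` holds iff `T` is isomorphic to `S(p, q)` for some
`p ≥ 2`, `q ≥ 3`, or `T` is a path on `q ≥ 2` vertices with `p₁ ≥ 2` pendant
leaves attached to one endpoint and `p₂ ≥ 2` pendant leaves attached to the
other endpoint. -/
theorem stmt_15 {V : Type*} [Fintype V] (G : SimpleGraph V) (hG : G.IsTree)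
    (hnotpath : ¬ Nonempty (G ≃g SimpleGraph.pathGraph (Fintype.card V)))
    (hnotstar : ¬ ∃ v : V, ∀ w : V, w ≠ v → G.Adj v w) :
    treeNumRed G = Nat.choose (twinLeaves G).ncard 2 + (twinLeaves G).ncard + 1 ↔
      ((∃ p q : ℕ, 2 ≤ p ∧ 3 ≤ q ∧ Nonempty (G ≃g Spq p q)) ∨
       (∃ p₁ p₂ q : ℕ, 2 ≤ p₁ ∧ 2 ≤ p₂ ∧ 2 ≤ q ∧
          Nonempty (G ≃g DoubleBroom p₁ p₂ q))) := by
  rw [TreeLines.treeNumRed_eq_iff hG hnotstar]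
  exact TreeLines.isBroomLike_iff hG hnotpath hnotstar
end

section
/- If S is the bi-coloured system derived from a tree T on n ≥ 6 vertices, then m_S ≥ ⌊n²/4 + n + 1⌋. -/
namespace SimpleGraph

variable {V : Type*} {G : SimpleGraph V}

/-- `x` is the only neighbour of `u`. -/
def IsLeafAt (G : SimpleGraph V) (u x : V) : Prop := ∀ y, G.Adj u y ↔ y = x

/-- `u` and `v` are equal, or they are leaves with a common neighbour. -/
def LeafTwin (G : SimpleGraph V) (u v : V) : Prop :=
  u = v ∨ ∃ x, G.IsLeafAt u x ∧ G.IsLeafAt v x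

lemma IsLeafAt.adj {u x : V} (h : G.IsLeafAt u x) : G.Adj u x := (h x).2 rfl

lemma IsLeafAt.unique {u x y : V} (h : G.IsLeafAt u x) (h' : G.IsLeafAt u y) : x = y :=
  (h' x).1 h.adj

lemma LeafTwin.symm {u v : V} (h : G.LeafTwin u v) : G.LeafTwin v u := by
  rcases h with h | ⟨x, h, h'⟩
  · exact .inl h.symm
  · exact .inr ⟨x, h', h⟩

lemma LeafTwin.trans {u v w : V} (h : G.LeafTwin u v) (h' : G.LeafTwin v w) :
    G.LeafTwin u w := by
  rcases h with rfl | ⟨x, hu, hv⟩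
  · exact h'
  rcases h' with rfl | ⟨y, hv', hw⟩
  · exact .inr ⟨x, hu, hv⟩
  · obtain rfl := hv.unique hv'
    exact .inr ⟨x, hu, hw⟩

/-- The equivalence relation given by `LeafTwin`. -/
def leafTwinSetoid (G : SimpleGraph V) : Setoid V where
  r := G.LeafTwin
  iseqv := ⟨fun _ => .inl rfl, LeafTwin.symm, LeafTwin.trans⟩

lemma Connected.exists_adj_dist_add_one (hG : G.Connected) {u v : V} (h : u ≠ v) :
    ∃ y, G.Adj v y ∧ G.dist u y + 1 = G.dist u v := by
  obtain ⟨p, hp⟩ := hG.exists_walk_length_eq_dist v u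
  cases p with
  | nil => exact absurd rfl h
  | @cons _ y _ hadj q =>
    refine ⟨y, hadj, ?_⟩
    have h1 := dist_le q
    have h2 := hG.dist_triangle (u := v) (v := y) (w := u)
    have h3 := dist_eq_one_iff_adj.2 hadj
    rw [Walk.length_cons] at hp
    rw [dist_comm (u := u), dist_comm (u := u)]
    omega

lemma IsTree.eq_of_adj_of_dist_add_one (hG : G.IsTree) {u v y z : V} (hy : G.Adj v y)
    (hz : G.Adj v z) (hy' : G.dist u y + 1 = G.dist u v) (hz' : G.dist u z + 1 = G.dist u v) :
    y = z := by
  obtain ⟨p, hp⟩ := hG.connected.exists_walk_length_eq_dist u y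
  obtain ⟨q, hq⟩ := hG.connected.exists_walk_length_eq_dist u z
  have h1 := (p.concat hy.symm).isPath_of_length_eq_dist (by rw [Walk.length_concat]; omega)
  have h2 := (q.concat hz.symm).isPath_of_length_eq_dist (by rw [Walk.length_concat]; omega)
  have h3 := Subtype.mk.inj (hG.isAcyclic.subsingleton_path u v |>.elim ⟨_, h1⟩ ⟨_, h2⟩)
  simpa using congrArg Walk.penultimate h3

lemma IsLeafAt.dist_eq (hG : G.Connected) {u x v : V} (h : G.IsLeafAt u x) (hv : v ≠ u) :
    G.dist v u = G.dist v x + 1 := by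
  obtain ⟨y, hy, hd⟩ := hG.exists_adj_dist_add_one hv
  rw [← (h y).1 hy, hd]

/-- Two geodesics overlapping in a nontrivial segment concatenate to a geodesic. -/
lemma IsTree.dist_eq_of_overlap (hG : G.IsTree) {u w v y : V}
    (h₁ : G.dist u w + G.dist w v = G.dist u v) (h₂ : G.dist w v + G.dist v y = G.dist w y)
    (hwv : w ≠ v) : G.dist u y = G.dist u w + G.dist w v + G.dist v y := by
  have hc := hG.connected
  induction hn : G.dist v y generalizing y with
  | zero =>
    obtain rfl := hc.dist_eq_zero_iff.1 hn
    omega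
  | succ n ih =>
    have hvy : v ≠ y := by rintro rfl; simp at hn
    obtain ⟨y', hy', hd⟩ := hc.exists_adj_dist_add_one hvy
    have h1 := dist_eq_one_iff_adj.2 hy'
    have t1 := hc.dist_triangle (u := w) (v := v) (w := y')
    have t2 := hc.dist_triangle (u := w) (v := y') (w := y)
    rw [dist_comm] at h1
    have e1 := ih (y := y') (by omega) (by omega)
    have hwy : w ≠ y' := by
      rintro rfl
      have := hc.pos_dist_of_ne hwv
      simp at t1 t2
      omega
    obtain ⟨z, hz, hdz⟩ := hc.exists_adj_dist_add_one hwy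
    have t3 := hc.dist_triangle (u := u) (v := w) (w := z)
    have t4 := hc.dist_triangle (u := u) (v := z) (w := y')
    have h2 := dist_eq_one_iff_adj.2 hz
    rw [dist_comm] at h2
    rcases hG.dist_eq_dist_add_one_of_adj u hy' with h | h
    · omega
    · have := hG.eq_of_adj_of_dist_add_one (u := u) hz hy'.symm (by omega) (by omega)
      subst this
      omega

lemma IsTree.collin_of_adj (hG : G.IsTree) {u v : V} (h : G.Adj u v) (w : V) :
    Collin G u v w := by
  have h1 := dist_eq_one_iff_adj.2 h
  have h2 := hG.dist_eq_dist_add_one_of_adj w h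
  have c1 := dist_comm (G := G) (u := u) (v := v)
  have c2 := dist_comm (G := G) (u := u) (v := w)
  have c3 := dist_comm (G := G) (u := w) (v := v)
  unfold Collin
  omega

/-- A vertex collinear with `r`, `s` and adjacent to a vertex not collinear with them lies on the
geodesic between `r` and `s`. -/
lemma IsTree.dist_add_dist_of_collin_of_not_collin (hG : G.IsTree) {r s p x : V}
    (hpx : G.Adj p x) (hxr : x ≠ r) (hxs : x ≠ s) (hx : Collin G r s x) (hp : ¬ Collin G r s p) :
    G.dist r x + G.dist x s = G.dist r s ∧ G.dist r p = G.dist r x + 1 := by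
  have hc := hG.connected
  have beyond : ∀ a b : V, x ≠ a → G.dist x a + G.dist a b = G.dist x b →
      G.dist p a + G.dist a b = G.dist p b := by
    intro a b hxa h
    have h1 := dist_eq_one_iff_adj.2 hpx
    have t1 := hc.dist_triangle (u := p) (v := a) (w := b)
    have t2 := hc.dist_triangle (u := x) (v := p) (w := b)
    have c := dist_comm (G := G) (u := x) (v := p)
    have c1 := dist_comm (G := G) (u := a) (v := p)
    have c2 := dist_comm (G := G) (u := a) (v := x)
    rcases hG.dist_eq_dist_add_one_of_adj a hpx with h3 | h3
    · have := hG.dist_eq_of_overlap (u := p) (y := b) (by omega) h hxa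
      omega
    · omega
  have c1 := dist_comm (G := G) (u := r) (v := s)
  have c2 := dist_comm (G := G) (u := r) (v := x)
  have c3 := dist_comm (G := G) (u := s) (v := x)
  have c4 := dist_comm (G := G) (u := r) (v := p)
  have c5 := dist_comm (G := G) (u := s) (v := p)
  have b1 := beyond r s hxr
  have b2 := beyond s r hxs
  have t1 := hc.dist_triangle (u := p) (v := x) (w := s)
  have t2 := hc.dist_triangle (u := r) (v := p) (w := s)
  have h1 := dist_eq_one_iff_adj.2 hpx
  have h2 := hG.dist_eq_dist_add_one_of_adj r hpx
  unfold Collin at hx hp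
  omega

lemma mem_treeBlueLine {u v w : V} :
    w ∈ treeBlueLine G u v ↔ w = u ∨ w = v ∨ ¬ Collin G u v w := by
  unfold treeBlueLine
  simp only [Set.mem_union, Set.mem_insert_iff, Set.mem_singleton_iff, Set.mem_ofPred_eq]
  tauto

lemma Collin.swap {u v w : V} (h : Collin G u v w) : Collin G v u w := by
  have c1 := dist_comm (G := G) (u := u) (v := v)
  have c2 := dist_comm (G := G) (u := u) (v := w)
  have c3 := dist_comm (G := G) (u := w) (v := v)
  unfold Collin at *
  omega

lemma treeBlueLine_comm (u v : V) : treeBlueLine G u v = treeBlueLine G v u := by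
  ext w
  have : Collin G u v w ↔ Collin G v u w := ⟨Collin.swap, Collin.swap⟩
  rw [mem_treeBlueLine, mem_treeBlueLine, this]
  tauto

lemma treeRedLine_comm (u v : V) : treeRedLine G u v = treeRedLine G v u := by
  ext w
  have : Collin G u v w ↔ Collin G v u w := ⟨Collin.swap, Collin.swap⟩
  simp only [treeRedLine, Set.mem_union, Set.mem_insert_iff, Set.mem_singleton_iff,
    Set.mem_ofPred_eq, this]
  tauto

lemma IsTree.treeBlueLine_of_adj (hG : G.IsTree) {u v : V} (h : G.Adj u v) :
    treeBlueLine G u v = {u, v} := by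
  ext w
  simp [mem_treeBlueLine, hG.collin_of_adj h w]

lemma IsTree.eq_of_treeBlueLine_eq_of_adj (hG : G.IsTree) {p q r s : V} (h : G.Adj p q)
    (hrs : r ≠ s) (he : treeBlueLine G p q = treeBlueLine G r s) : s(p, q) = s(r, s) := by
  rw [hG.treeBlueLine_of_adj h] at he
  have hr : r ∈ treeBlueLine G r s := mem_treeBlueLine.2 (.inl rfl)
  have hs : s ∈ treeBlueLine G r s := mem_treeBlueLine.2 (.inr (.inl rfl))
  rw [← he] at hr hs
  simp only [Set.mem_insert_iff, Set.mem_singleton_iff] at hr hs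
  grind

/-- An endpoint of a pair generating a blue line that is not an endpoint of another pair generating
the same line is a leaf attached to the geodesic between the latter. -/
lemma IsTree.exists_isLeafAt_of_treeBlueLine_eq (hG : G.IsTree) {p q r s : V} (hpq : p ≠ q)
    (hrs : r ≠ s) (he : treeBlueLine G p q = treeBlueLine G r s) (hpr : p ≠ r) (hps : p ≠ s) :
    ∃ x, G.IsLeafAt p x ∧ x ≠ r ∧ x ≠ s ∧ x ≠ q ∧ G.dist r x + G.dist x s = G.dist r s := by
  have hc := hG.connected
  have hnadj : ¬ G.Adj p q := by
    intro h
    have := hG.eq_of_treeBlueLine_eq_of_adj h hrs he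
    grind
  have hp : ¬ Collin G r s p := by
    have : p ∈ treeBlueLine G r s := he ▸ mem_treeBlueLine.2 (.inl rfl)
    rw [mem_treeBlueLine] at this
    tauto
  have key : ∀ y, G.Adj p y → y ≠ r ∧ y ≠ s ∧ y ≠ q ∧
      G.dist r y + G.dist y s = G.dist r s ∧ G.dist r p = G.dist r y + 1 := by
    intro y hy
    have h1 : y ∉ treeBlueLine G p q := by
      have h1 := hG.collin_of_adj hy q
      have h2 : Collin G p q y := by
        have c1 := dist_comm (G := G) (u := p) (v := q)
        have c2 := dist_comm (G := G) (u := p) (v := y)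
        have c3 := dist_comm (G := G) (u := q) (v := y)
        unfold Collin at *
        omega
      have := hy.ne'
      have : y ≠ q := by rintro rfl; exact hnadj hy
      rw [mem_treeBlueLine]
      tauto
    have h2 := h1
    rw [he] at h1
    simp only [mem_treeBlueLine, not_or, not_not] at h1 h2
    exact ⟨h1.1, h1.2.1, h2.2.1,
      hG.dist_add_dist_of_collin_of_not_collin hy h1.1 h1.2.1 h1.2.2 hp⟩
  obtain ⟨x, hx, -⟩ := hc.exists_adj_dist_add_one hpr.symm
  refine ⟨x, fun y => ⟨fun hy => ?_, fun h => h ▸ hx⟩, ?_⟩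
  · exact hG.eq_of_adj_of_dist_add_one (u := r) hy hx (key y hy).2.2.2.2.symm
      (key x hx).2.2.2.2.symm
  · have := key x hx
    tauto

lemma IsTree.leafTwin_of_treeBlueLine_eq_left (hG : G.IsTree) {p q s : V} (hpq : p ≠ q)
    (hps : p ≠ s) (he : treeBlueLine G p q = treeBlueLine G p s) : G.LeafTwin q s := by
  have hc := hG.connected
  by_cases hqs : q = s
  · exact .inl hqs
  obtain ⟨y, hy, hy1, hy2, -, hy3⟩ := hG.exists_isLeafAt_of_treeBlueLine_eq (p := q) (q := p)
    hpq.symm hps (by rw [treeBlueLine_comm, he]) hpq.symm hqs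
  obtain ⟨w, hw, hw1, hw2, -, hw3⟩ := hG.exists_isLeafAt_of_treeBlueLine_eq (p := s) (q := p)
    hps.symm hpq (by rw [treeBlueLine_comm, he]) hps.symm (Ne.symm hqs)
  have e1 := hy.dist_eq hc hpq
  have e2 := hw.dist_eq hc hps
  have e3 := hy.dist_eq hc hw2
  have e4 := hw.dist_eq hc hy2
  have c := dist_comm (G := G) (u := y) (v := w)
  have : y = w := hc.dist_eq_zero_iff.1 (by omega)
  exact .inr ⟨y, hy, this ▸ hw⟩

lemma IsTree.eq_and_eq_or_of_dist (hG : G.IsTree) {x y z w : V}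
    (h1 : G.dist z x + G.dist x w = G.dist z w) (h2 : G.dist z y + G.dist y w = G.dist z w)
    (h3 : G.dist x z + G.dist z y = G.dist x y) (h4 : G.dist x w + G.dist w y = G.dist x y) :
    x = z ∧ y = w ∨ x = w ∧ y = z := by
  have hc := hG.connected
  have c1 := dist_comm (G := G) (u := x) (v := z)
  have c2 := dist_comm (G := G) (u := x) (v := w)
  have c3 := dist_comm (G := G) (u := y) (v := w)
  have c4 := dist_comm (G := G) (u := z) (v := w)
  by_cases hxz : x = z
  · subst hxz
    exact .inl ⟨rfl, hc.dist_eq_zero_iff.1 (by omega)⟩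
  · have := hG.dist_eq_of_overlap (u := w) (w := x) (v := z) (y := y) (by omega) h3 hxz
    have c5 := dist_comm (G := G) (u := y) (v := z)
    exact .inr ⟨hc.dist_eq_zero_iff.1 (by omega), hc.dist_eq_zero_iff.1 (by omega)⟩

/-- In a tree, pairs generating the same blue line agree up to leaf twins. -/
theorem IsTree.leafTwin_of_treeBlueLine_eq (hG : G.IsTree) {p q r s : V} (hpq : p ≠ q)
    (hrs : r ≠ s) (he : treeBlueLine G p q = treeBlueLine G r s) :
    G.LeafTwin p r ∧ G.LeafTwin q s ∨ G.LeafTwin p s ∧ G.LeafTwin q r := by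
  have hc := hG.connected
  have rfl' : ∀ u, G.LeafTwin u u := fun u => .inl rfl
  by_cases hpr : p = r
  · subst hpr
    exact .inl ⟨rfl' p, hG.leafTwin_of_treeBlueLine_eq_left hpq hrs he⟩
  by_cases hps : p = s
  · subst hps
    rw [treeBlueLine_comm r] at he
    exact .inr ⟨rfl' p, hG.leafTwin_of_treeBlueLine_eq_left hpq hrs.symm he⟩
  by_cases hqr : q = r
  · subst hqr
    rw [treeBlueLine_comm p] at he
    exact .inr ⟨hG.leafTwin_of_treeBlueLine_eq_left hpq.symm hrs he, rfl' q⟩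
  by_cases hqs : q = s
  · subst hqs
    rw [treeBlueLine_comm p, treeBlueLine_comm r] at he
    exact .inl ⟨hG.leafTwin_of_treeBlueLine_eq_left hpq.symm hrs.symm he, rfl' q⟩
  obtain ⟨x, hx, hxr, hxs, hxq, hx'⟩ :=
    hG.exists_isLeafAt_of_treeBlueLine_eq hpq hrs he hpr hps
  obtain ⟨y, hy, hyr, hys, hyp, hy'⟩ :=
    hG.exists_isLeafAt_of_treeBlueLine_eq (p := q) (q := p) hpq.symm hrs
      (by rw [treeBlueLine_comm, he]) hqr hqs
  obtain ⟨z, hz, hzp, hzq, hzs, hz'⟩ :=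
    hG.exists_isLeafAt_of_treeBlueLine_eq hrs hpq he.symm (Ne.symm hpr) (Ne.symm hqr)
  obtain ⟨w, hw, hwp, hwq, hwr, hw'⟩ :=
    hG.exists_isLeafAt_of_treeBlueLine_eq (p := s) (q := r) hrs.symm hpq
      (by rw [treeBlueLine_comm, he]) (Ne.symm hps) (Ne.symm hqs)
  have shrink : ∀ {a b c d m : V}, G.IsLeafAt a c → G.IsLeafAt b d → a ≠ b → c ≠ b → m ≠ a →
      m ≠ b → G.dist a m + G.dist m b = G.dist a b → G.dist c m + G.dist m d = G.dist c d := by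
    intro a b c d m ha hb hab hcb hma hmb h
    have e1 := ha.dist_eq hc hma
    have e2 := hb.dist_eq hc hmb
    have e3 := hb.dist_eq hc hab
    have e4 := hb.dist_eq hc hcb
    have e5 := ha.dist_eq hc hab.symm
    rw [dist_comm] at e1 e5
    rw [dist_comm (u := m)] at e1
    rw [dist_comm (u := b)] at e5
    omega
  rcases hG.eq_and_eq_or_of_dist (shrink hz hw hrs hzs hxr hxs hx')
    (shrink hz hw hrs hzs hyr hys hy') (shrink hx hy hpq hxq hzp hzq hz')
    (shrink hx hy hpq hxq hwp hwq hw') with ⟨rfl, rfl⟩ | ⟨rfl, rfl⟩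
  · exact .inl ⟨.inr ⟨_, hx, hz⟩, .inr ⟨_, hy, hw⟩⟩
  · exact .inr ⟨.inr ⟨_, hx, hw⟩, .inr ⟨_, hy, hz⟩⟩

lemma IsLeafAt.eq_or_eq_of_dist (hG : G.Connected) {u v w x : V} (h : G.IsLeafAt u x)
    (huv : G.dist v u + G.dist u w = G.dist v w) : u = v ∨ u = w := by
  by_contra! hne
  have e1 := h.dist_eq hG hne.1.symm
  have e2 := h.dist_eq hG hne.2.symm
  have t := hG.dist_triangle (u := v) (v := x) (w := w)
  rw [dist_comm (u := u)] at huv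
  rw [dist_comm (u := x)] at t
  omega

lemma IsLeafAt.mem_treeRedLine (hG : G.Connected) {u v w x y z : V} (hu : G.IsLeafAt u x)
    (hv : G.IsLeafAt v y) (hw : G.IsLeafAt w z) (huv : u ≠ v) :
    w ∈ treeRedLine G u v ↔ w = u ∨ w = v := by
  simp only [treeRedLine, Set.mem_union, Set.mem_insert_iff, Set.mem_singleton_iff,
    Set.mem_ofPred_eq, or_iff_left_iff_imp]
  rintro ⟨hwu, hwv, h | h | h⟩
  · have := hv.eq_or_eq_of_dist hG h
    grind
  · have := hu.eq_or_eq_of_dist hG h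
    grind
  · have := hw.eq_or_eq_of_dist hG h
    grind

lemma IsTree.treeRedLine_of_adj (hG : G.IsTree) {u v : V} (h : G.Adj u v) :
    treeRedLine G u v = Set.univ := by
  ext w
  have := hG.collin_of_adj h w
  simp only [treeRedLine, Set.mem_union, Set.mem_insert_iff, Set.mem_singleton_iff,
    Set.mem_ofPred_eq, Set.mem_univ]
  tauto

/-- The red line generated by an unordered pair. -/
def redLineOfPair (G : SimpleGraph V) : Sym2 V → Set V :=
  Sym2.lift ⟨treeRedLine G, treeRedLine_comm⟩

/-- The blue line generated by an unordered pair. -/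
def blueLineOfPair (G : SimpleGraph V) : Sym2 V → Set V :=
  Sym2.lift ⟨treeBlueLine G, treeBlueLine_comm⟩

lemma IsTree.univ_mem_treeRedLines [Nontrivial V] (hG : G.IsTree) :
    Set.univ ∈ treeRedLines G := by
  obtain ⟨u, v, huv⟩ := exists_pair_ne V
  obtain ⟨y, hy, -⟩ := hG.connected.exists_adj_dist_add_one huv
  exact ⟨v, y, hy.ne, (hG.treeRedLine_of_adj hy).symm⟩

lemma IsTree.map_eq_of_blueLineOfPair_eq (hG : G.IsTree) {e e' : Sym2 V} (he : ¬ e.IsDiag)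
    (he' : ¬ e'.IsDiag) (h : blueLineOfPair G e = blueLineOfPair G e') :
    e.map (Quotient.mk G.leafTwinSetoid) = e'.map (Quotient.mk G.leafTwinSetoid) := by
  induction e with | _ p q
  induction e' with | _ r s
  have hs : ∀ {u v}, G.LeafTwin u v →
      Quotient.mk G.leafTwinSetoid u = Quotient.mk G.leafTwinSetoid v :=
    fun h => Quotient.sound (s := G.leafTwinSetoid) h
  rw [Sym2.map_mk, Sym2.map_mk, Sym2.eq_iff]
  rcases hG.leafTwin_of_treeBlueLine_eq he he' h with ⟨h1, h2⟩ | ⟨h1, h2⟩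
  · exact .inl ⟨hs h1, hs h2⟩
  · exact .inr ⟨hs h1, hs h2⟩

section Counting

variable [Fintype V]

lemma IsTree.one_le_treeNumRed [Nontrivial V] (hG : G.IsTree) : 1 ≤ treeNumRed G :=
  (Set.ncard_pos (Set.toFinite _)).2 ⟨_, hG.univ_mem_treeRedLines⟩

/-- Distinct pairs of leaves of a tree generate distinct red lines, none of them the line `univ`
generated by an edge. -/
lemma IsTree.choose_two_add_one_le_treeNumRed [DecidableEq V] [Nontrivial V] (hG : G.IsTree)
    {L : Finset V} (hL : ∀ u ∈ L, ∃ x, G.IsLeafAt u x) (h3 : 3 ≤ L.card) :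
    L.card.choose 2 + 1 ≤ treeNumRed G := by
  classical
  set P := L.offDiag.image Sym2.mk.uncurry with hP
  have hmem : ∀ u ∈ L, ∀ v ∈ L, u ≠ v → ∀ w ∈ L,
      (w ∈ treeRedLine G u v ↔ w = u ∨ w = v) := by
    intro u hu v hv huv w hw
    obtain ⟨x, hx⟩ := hL u hu
    obtain ⟨y, hy⟩ := hL v hv
    obtain ⟨z, hz⟩ := hL w hw
    exact hx.mem_treeRedLine hG.connected hy hz huv
  have hinj : Set.InjOn (redLineOfPair G) P := by
    intro e he e' he' h
    induction e with | _ u v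
    induction e' with | _ r s
    simp only [hP, Finset.coe_image, Set.mem_image, Finset.mem_coe, Finset.mem_offDiag,
      Prod.exists, Function.uncurry_apply_pair] at he he'
    obtain ⟨u, v, ⟨hu, hv, huv⟩, he⟩ := he
    obtain ⟨r, s, ⟨hr, hs, hrs⟩, he'⟩ := he'
    rw [← he, ← he'] at h ⊢
    simp only [redLineOfPair, Sym2.lift_mk] at h
    have h1 := hmem u hu v hv huv r hr
    have h2 := hmem u hu v hv huv s hs
    rw [h, hmem r hr s hs hrs r hr] at h1
    rw [h, hmem r hr s hs hrs s hs] at h2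
    grind
  have huniv : Set.univ ∉ P.image (redLineOfPair G) := by
    simp only [hP, Finset.mem_image, Finset.mem_offDiag, Prod.exists, not_exists, not_and,
      Function.uncurry_apply_pair, forall_exists_index, and_imp]
    rintro e u v hu hv huv rfl h
    obtain ⟨w, hw, hwn⟩ : ∃ w ∈ L, w ∉ ({u, v} : Finset V) :=
      Finset.exists_mem_notMem_of_card_lt_card (Finset.card_le_two.trans_lt h3)
    have := (hmem u hu v hv huv w hw).1 (by
      simp only [redLineOfPair, Sym2.lift_mk] at h
      rw [h]; trivial)
    simp at hwn
    tauto
  have hsub : ((insert Set.univ (P.image (redLineOfPair G)) : Finset (Set V)) : Set (Set V)) ⊆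
      treeRedLines G := by
    intro l hl
    rw [Finset.mem_coe, Finset.mem_insert] at hl
    rcases hl with rfl | hl
    · exact hG.univ_mem_treeRedLines
    · simp only [hP, Finset.mem_image, Finset.mem_offDiag, Prod.exists,
        Function.uncurry_apply_pair] at hl
      obtain ⟨e, ⟨u, v, ⟨hu, hv, huv⟩, rfl⟩, rfl⟩ := hl
      exact ⟨u, v, huv, rfl⟩
  have := Set.ncard_le_ncard hsub (Set.toFinite _)
  rwa [Set.ncard_coe_finset, Finset.card_insert_of_notMem huniv, Finset.card_image_of_injOn hinj,
    hP, Sym2.card_image_offDiag] at this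

lemma card_le_treeNumBlue {P : Finset (Sym2 V)} (hP : ∀ e ∈ P, ¬ e.IsDiag)
    (hinj : Set.InjOn (blueLineOfPair G) P) : P.card ≤ treeNumBlue G := by
  classical
  rw [← Finset.card_image_of_injOn hinj, ← Set.ncard_coe_finset]
  refine Set.ncard_le_ncard ?_ (Set.toFinite _)
  intro l hl
  simp only [Finset.coe_image, Set.mem_image, Finset.mem_coe] at hl
  obtain ⟨e, he, rfl⟩ := hl
  induction e with | _ u v
  exact ⟨u, v, hP _ he, rfl⟩

/-- Let `Q` contain no two leaf twins. The pairs in `Q`, the edges at leaves outside `Q`, and one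
pair of leaf twins generate distinct blue lines. -/
lemma IsTree.card_le_treeNumBlue_of_transversal [DecidableEq V] (hG : G.IsTree) {Q : Finset V}
    (hQ : Set.InjOn (Quotient.mk G.leafTwinSetoid) Q)
    (hQc : ∀ u ∉ Q, ∃ x, G.IsLeafAt u x) {a b c : V} (hab : a ≠ b) (ha : G.IsLeafAt a c)
    (hb : G.IsLeafAt b c) (hcQ : ∀ u x, u ∉ Q → G.IsLeafAt u x → x ∈ Q) :
    Q.card.choose 2 + Qᶜ.card + 1 ≤ treeNumBlue G := by
  classical
  choose! f hf using hQc
  set A := Q.offDiag.image Sym2.mk.uncurry with hA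
  set B := Qᶜ.image (fun u => s(u, f u)) with hB
  have memA : ∀ e ∈ A, ∃ u v, u ∈ Q ∧ v ∈ Q ∧ u ≠ v ∧ e = s(u, v) := by
    intro e he
    simp only [hA, Finset.mem_image, Finset.mem_offDiag, Prod.exists,
      Function.uncurry_apply_pair] at he
    obtain ⟨u, v, ⟨hu, hv, huv⟩, rfl⟩ := he
    exact ⟨u, v, hu, hv, huv, rfl⟩
  have memB : ∀ e ∈ B, ∃ u v, u ∉ Q ∧ v ∈ Q ∧ G.Adj u v ∧ e = s(u, v) := by
    intro e he
    simp only [hB, Finset.mem_image, Finset.mem_compl] at he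
    obtain ⟨u, hu, rfl⟩ := he
    exact ⟨u, f u, hu, hcQ u _ hu (hf u hu), (hf u hu).adj, rfl⟩
  have hAB : Disjoint A B := by
    rw [Finset.disjoint_left]
    intro e h1 h2
    obtain ⟨u, v, hu, hv, -, rfl⟩ := memA e h1
    obtain ⟨r, s, hr, hs, -, h⟩ := memB _ h2
    grind
  have hBcard : B.card = Qᶜ.card := by
    refine Finset.card_image_of_injOn ?_
    intro u hu v hv h
    simp only [Finset.coe_compl, Set.mem_compl_iff, Finset.mem_coe] at hu hv
    have h1 := hcQ u _ hu (hf u hu)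
    have h2 := hcQ v _ hv (hf v hv)
    simp only at h
    grind
  have hnab : ¬ G.Adj a b := by
    intro h
    have h1 : b = c := (ha b).1 h
    have h2 : a = c := (hb a).1 h.symm
    exact hab (h2.trans h1.symm)
  have habs : Quotient.mk G.leafTwinSetoid a = Quotient.mk G.leafTwinSetoid b :=
    Quotient.sound (s := G.leafTwinSetoid) (.inr ⟨c, ha, hb⟩)
  have hCA : s(a, b) ∉ A := by
    intro h
    obtain ⟨u, v, hu, hv, huv, h⟩ := memA _ h
    have := @hQ u hu v hv
    grind
  have hCB : s(a, b) ∉ B := by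
    intro h
    obtain ⟨u, v, hu, hv, huv, h⟩ := memB _ h
    have := huv.symm
    grind
  have hC : s(a, b) ∉ A ∪ B := by simp [hCA, hCB]
  have hdiag : ∀ e ∈ insert s(a, b) (A ∪ B), ¬ e.IsDiag := by
    intro e he
    simp only [Finset.mem_insert, Finset.mem_union] at he
    rcases he with rfl | he | he
    · simpa
    · obtain ⟨u, v, -, -, huv, rfl⟩ := memA e he
      simpa
    · obtain ⟨u, v, -, -, huv, rfl⟩ := memB e he
      simpa using huv.ne
  have adjB : ∀ e ∈ B, ∀ e' : Sym2 V, ¬ e'.IsDiag → blueLineOfPair G e = blueLineOfPair G e' →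
      e = e' := by
    intro e he e' he' h
    obtain ⟨u, v, -, -, huv, rfl⟩ := memB e he
    induction e' with | _ r s
    exact hG.eq_of_treeBlueLine_eq_of_adj huv he' h
  have hinj : Set.InjOn (blueLineOfPair G) (insert s(a, b) (A ∪ B) : Finset (Sym2 V)) := by
    intro e he e' he' h
    rw [Finset.mem_coe] at he he'
    have hd := hdiag e he
    have hd' := hdiag e' he'
    by_cases heB : e ∈ B
    · exact adjB e heB e' hd' h
    by_cases heB' : e' ∈ B
    · exact (adjB e' heB' e hd h.symm).symm
    have hm := hG.map_eq_of_blueLineOfPair_eq hd hd' h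
    have diagA : ∀ e ∈ A, ¬ (e.map (Quotient.mk G.leafTwinSetoid)).IsDiag := by
      intro e he
      obtain ⟨u, v, hu, hv, huv, rfl⟩ := memA e he
      simpa using fun h => huv (hQ hu hv h)
    have diagC : (s(a, b).map (Quotient.mk G.leafTwinSetoid)).IsDiag := by
      simpa using habs
    simp only [Finset.mem_insert, Finset.mem_union, heB, heB', or_false] at he he'
    rcases he with rfl | he <;> rcases he' with rfl | he'
    · rfl
    · exact absurd (hm ▸ diagC) (diagA e' he')
    · exact absurd (hm ▸ diagC) (diagA e he)
    · obtain ⟨u, v, hu, hv, huv, rfl⟩ := memA e he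
      obtain ⟨r, s, hr, hs, hrs, rfl⟩ := memA e' he'
      rw [Sym2.map_mk, Sym2.map_mk, Sym2.eq_iff] at hm
      rcases hm with ⟨h1, h2⟩ | ⟨h1, h2⟩
      · rw [hQ hu hr h1, hQ hv hs h2]
      · rw [hQ hu hs h1, hQ hv hr h2, Sym2.eq_swap]
  have := card_le_treeNumBlue hdiag hinj
  rwa [Finset.card_insert_of_notMem hC, Finset.card_union_of_disjoint hAB, hBcard, hA,
    Sym2.card_image_offDiag] at this

/-- In a tree without leaf twins all pairs of vertices generate distinct blue lines. -/
lemma IsTree.choose_two_le_treeNumBlue (hG : G.IsTree) (h : ∀ u v, G.LeafTwin u v → u = v) :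
    (Fintype.card V).choose 2 ≤ treeNumBlue G := by
  classical
  rw [← Finset.card_univ, ← Sym2.card_image_offDiag]
  have hd : ∀ e ∈ (Finset.univ : Finset V).offDiag.image Sym2.mk.uncurry, ¬ e.IsDiag := by
    intro e he
    simp only [Finset.mem_image, Finset.mem_offDiag, Prod.exists,
      Function.uncurry_apply_pair] at he
    obtain ⟨u, v, ⟨-, -, huv⟩, rfl⟩ := he
    simpa
  refine card_le_treeNumBlue hd fun e he e' he' heq => ?_
  refine Sym2.map.injective (fun u v huv => h u v ?_)
    (hG.map_eq_of_blueLineOfPair_eq (hd e he) (hd e' he') heq)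
  exact Quotient.exact (s := G.leafTwinSetoid) huv

/-- A tree whose leaves share their neighbour `c` is a star with centre `c`. -/
lemma IsTree.isLeafAt_of_forall (hG : G.IsTree) {c : V}
    (h : ∀ u x, G.IsLeafAt u x → x = c) {v : V} (hv : v ≠ c) : G.IsLeafAt v c := by
  have hc := hG.connected
  obtain ⟨m, -, hm⟩ := Finset.exists_max_image Finset.univ (G.dist c) ⟨c, Finset.mem_univ c⟩
  have hmax : ∀ w, G.dist c w ≤ G.dist c m := fun w => hm w (Finset.mem_univ w)
  have hmc : c ≠ m := by
    rintro rfl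
    have := hmax v
    have := hc.pos_dist_of_ne hv.symm
    rw [dist_self] at *
    omega
  obtain ⟨x, hx, hxd⟩ := hc.exists_adj_dist_add_one hmc
  have hleaf : G.IsLeafAt m x := by
    refine fun y => ⟨fun hy => hG.eq_of_adj_of_dist_add_one (u := c) hy hx ?_ hxd,
      fun h => h ▸ hx⟩
    have := hmax y
    have := hG.dist_eq_dist_add_one_of_adj c hy
    omega
  obtain rfl := h m x hleaf
  have hm1 : G.dist x m = 1 := dist_eq_one_iff_adj.2 hx.symm
  have hdist : ∀ w, w ≠ x → G.dist x w = 1 := by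
    intro w hw
    have := hmax w
    have := hc.pos_dist_of_ne hw.symm
    omega
  refine fun y => ⟨fun hy => ?_, ?_⟩
  · by_contra hyx
    have := hdist y hyx
    have := hdist v hv
    have := hG.dist_eq_dist_add_one_of_adj x hy
    omega
  · rintro rfl
    exact (dist_eq_one_iff_adj.1 (hdist v hv)).symm

end Counting

lemma IsTree.eq_or_eq_of_isLeafAt (hG : G.IsTree) {u x v : V} (hu : G.IsLeafAt u x)
    (hx : G.IsLeafAt x u) : v = u ∨ v = x := by
  by_contra! h
  have h1 := hu.dist_eq hG.connected h.1
  have h2 := hx.dist_eq hG.connected h.2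
  omega

end SimpleGraph

lemma Nat.two_mul_choose_two_add (m : ℕ) : 2 * m.choose 2 + m = m * m := by
  induction m with
  | zero => rfl
  | succ m ih =>
    rw [Nat.choose_succ_succ' m 1, Nat.choose_one_right]
    linarith

/-- For the system derived from a tree on `n ≥ 6` vertices,
`m_S ≥ ⌊n²/4 + n + 1⌋ = ⌊n²/4⌋ + n + 1`. -/
theorem stmt_16 {V : Type*} [Fintype V] (G : SimpleGraph V) (hG : G.IsTree)
    (hn : 6 ≤ Fintype.card V) :
    Fintype.card V ^ 2 / 4 + Fintype.card V + 1 ≤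
      treeNumRed G + treeNumBlue G := by
  classical
  obtain ⟨n, hncard⟩ : ∃ n, n = Fintype.card V := ⟨_, rfl⟩
  rw [← hncard] at hn ⊢
  have : Nontrivial V := Fintype.one_lt_card_iff_nontrivial.1 (by omega)
  by_cases htw : ∀ u v, G.LeafTwin u v → u = v
  · have h1 := hG.choose_two_le_treeNumBlue htw
    have h2 := hG.one_le_treeNumRed
    have h3 := Nat.two_mul_choose_two_add n
    rw [← hncard] at h1
    have h4 : 6 * n ≤ n * n := Nat.mul_le_mul_right n hn
    rw [pow_two]
    omega
  push Not at htw
  obtain ⟨a, b, hab', hab⟩ := htw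
  obtain ⟨c, ha, hb⟩ := hab'.resolve_left hab
  set rep : V → V := fun v => (Quotient.mk G.leafTwinSetoid v).out with hrep
  have rep_twin : ∀ v, G.LeafTwin (rep v) v := fun v =>
    Quotient.mk_out (s := G.leafTwinSetoid) v
  have rep_rep : ∀ v, rep (rep v) = rep v := fun v =>
    congrArg Quotient.out (Quotient.out_eq (Quotient.mk G.leafTwinSetoid v))
  have rep_leaf : ∀ v x, G.IsLeafAt v x → G.IsLeafAt (rep v) x := by
    intro v x hv
    rcases rep_twin v with h | ⟨y, h, h'⟩
    · rwa [h]
    · exact hv.unique h' ▸ h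
  set Q : Finset V := Finset.univ.filter fun v => rep v = v with hQdef
  have memQ : ∀ v, v ∈ Q ↔ rep v = v := fun v => by simp [hQdef]
  have hQ : Set.InjOn (Quotient.mk G.leafTwinSetoid) Q := by
    intro u hu v hv h
    rw [Finset.mem_coe, memQ] at hu hv
    rw [← hu, ← hv]
    exact congrArg Quotient.out h
  have hQc : ∀ u ∉ Q, ∃ x, G.IsLeafAt u x := by
    intro u hu
    rw [memQ] at hu
    obtain ⟨x, -, hx⟩ := (rep_twin u).resolve_left hu
    exact ⟨x, hx⟩
  have hcQ : ∀ u x, u ∉ Q → G.IsLeafAt u x → x ∈ Q := by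
    intro u x _ hux
    by_contra hxQ
    obtain ⟨z, hz⟩ := hQc x hxQ
    obtain rfl : u = z := (hz u).1 hux.adj.symm
    obtain ⟨v, -, hv⟩ := Finset.exists_mem_notMem_of_card_lt_card
      (s := {u, x}) (t := Finset.univ)
      (Finset.card_le_two.trans_lt (by rw [Finset.card_univ]; omega))
    have := hG.eq_or_eq_of_isLeafAt (v := v) hux hz
    simp at hv
    tauto
  have hblue := hG.card_le_treeNumBlue_of_transversal hQ hQc hab ha hb hcQ
  set L : Finset V := Finset.univ.filter fun v => ∃ x, G.IsLeafAt v x with hLdef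
  have memL : ∀ v, v ∈ L ↔ ∃ x, G.IsLeafAt v x := fun v => by simp [hLdef]
  have hred := hG.choose_two_add_one_le_treeNumRed (L := L) fun u hu => (memL u).1 hu
  have hcard : Q.card + Qᶜ.card = n := by
    rw [Finset.card_add_card_compl, hncard]
  by_cases hstar : ∀ u x, G.IsLeafAt u x → x = c
  · have hL : n - 1 ≤ L.card := by
      rw [hncard, ← Finset.card_univ, ← Finset.card_erase_of_mem (Finset.mem_univ c)]
      refine Finset.card_le_card fun v hv => (memL v).2 ⟨c, ?_⟩
      exact hG.isLeafAt_of_forall hstar (Finset.ne_of_mem_erase hv)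
    have hred' := hred (by omega)
    have h1 := Nat.choose_le_choose 2 hL
    have h2 := Nat.two_mul_choose_two_add (n - 1)
    have h3 := Nat.two_mul_choose_two_add Q.card
    obtain ⟨m, rfl⟩ : ∃ m, n = m + 6 := ⟨n - 6, by omega⟩
    have h4 : 3 * Q.card ≤ Q.card * Q.card + 2 := by
      rcases Nat.lt_or_ge Q.card 3 with h | h
      · interval_cases Q.card <;> simp
      · exact (Nat.mul_le_mul_right _ h).trans (Nat.le_add_right _ _)
    rw [pow_two]
    have h5 : (m + 6 - 1) * (m + 6 - 1) = m * m + 10 * m + 25 := by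
      rw [show m + 6 - 1 = m + 5 by omega]; ring
    have h6 : (m + 6) * (m + 6) = m * m + 12 * m + 36 := by ring
    omega
  · push Not at hstar
    obtain ⟨u, x, hux, hxc⟩ := hstar
    have hne : rep a ≠ rep u := by
      intro h
      exact hxc ((rep_leaf u x hux).unique (h ▸ rep_leaf a c ha))
    have hL : Qᶜ.card + 2 ≤ L.card := by
      rw [← Finset.card_pair hne, ← Finset.card_union_of_disjoint]
      · refine Finset.card_le_card fun v hv => (memL v).2 ?_
        simp only [Finset.mem_union, Finset.mem_compl, Finset.mem_insert,
          Finset.mem_singleton] at hv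
        rcases hv with hv | rfl | rfl
        · exact hQc v hv
        · exact ⟨c, rep_leaf a c ha⟩
        · exact ⟨x, rep_leaf u x hux⟩
      · rw [Finset.disjoint_left]
        intro v hv hv'
        rw [Finset.mem_compl, memQ] at hv
        simp only [Finset.mem_insert, Finset.mem_singleton] at hv'
        rcases hv' with rfl | rfl <;> exact hv (rep_rep _)
    have hk : 1 ≤ Qᶜ.card := by
      refine Finset.card_pos.2 ?_
      by_contra hempty
      rw [Finset.not_nonempty_iff_eq_empty, Finset.compl_eq_empty_iff] at hempty
      refine hab (hQ (by simp [hempty]) (by simp [hempty]) ?_)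
      exact Quotient.sound (s := G.leafTwinSetoid) hab'
    have hred' := hred (by omega)
    have h1 := Nat.choose_le_choose 2 hL
    have h2 := Nat.two_mul_choose_two_add (Qᶜ.card + 2)
    have h3 := Nat.two_mul_choose_two_add Q.card
    generalize Qᶜ.card = k at *
    generalize Q.card = q at *
    have h4 : n ^ 2 + 4 * (k + q) + 2 * q ≤
        2 * ((k + 2) * (k + 2)) + 2 * (q * q) + 2 * k + 1 := by
      rw [← hcard]
      zify
      nlinarith [sq_nonneg ((k : ℤ) - q + 3)]
    omega
end

section
/- If S is the bi-coloured system derived from a tree T on n vertices with 3 ≤ n ≤ 6, then m_S ≥ n(n−1)/2 + 1. -/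
/-- Distances in the rooted tree on `0, …, ps.length` in which the head of each suffix `p :: qs` of
`ps` is the parent of the vertex `qs.length + 1`. -/
def parentDist : List ℕ → ℕ → ℕ → ℕ
  | [], _, _ => 0
  | p :: ps, i, j =>
    bif i == ps.length + 1 then
      bif j == ps.length + 1 then 0 else parentDist ps p j + 1
    else
      bif j == ps.length + 1 then parentDist ps i p + 1 else parentDist ps i j

/-- Boolean collinearity of a triple with respect to a distance function. -/
def collinBool (d : ℕ → ℕ → ℕ) (i j k : ℕ) : Bool :=
  d i j + d j k == d i k || d j i + d i k == d j k || d i k + d k j == d i j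

/-- The line of `i` and `j` in the colour `b` (red is `true`), encoded as a bit mask. -/
def lineMask (d : ℕ → ℕ → ℕ) (b : Bool) (n i j : ℕ) : ℕ :=
  ((List.range n).map fun k =>
    bif k == i || k == j || collinBool d i j k == b then 2 ^ k else 0).sum

/-- The number of distinct bit masks of lines in the colour `b`. -/
def numMasks (d : ℕ → ℕ → ℕ) (b : Bool) (n : ℕ) : ℕ :=
  ((List.range n).flatMap fun i => (List.range i).map fun j => lineMask d b n i j).dedup.length

/-- All parent lists of rooted trees on `0, …, n` with parents preceding their children. -/
def parentLists : ℕ → List (List ℕ)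
  | 0 => [[]]
  | n + 1 => (parentLists n).flatMap fun ps => (List.range (n + 1)).map (· :: ps)

/-- All trees on `n + 1` vertices have more than `(n + 1).choose 2` lines. -/
def manyLines (n : ℕ) : Bool :=
  (parentLists n).all fun ps =>
    ((n + 1) * n / 2 + 1).ble
      (numMasks (parentDist ps) true (n + 1) + numMasks (parentDist ps) false (n + 1))

theorem manyLines_two : manyLines 2 = true := by decide +kernel

theorem manyLines_three : manyLines 3 = true := by decide +kernel

theorem manyLines_four : manyLines 4 = true := by decide +kernel

theorem manyLines_five : manyLines 5 = true := by decide +kernel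

theorem length_of_mem_parentLists {n : ℕ} {ps : List ℕ} (h : ps ∈ parentLists n) :
    ps.length = n := by
  induction n generalizing ps with
  | zero => simp_all [parentLists]
  | succ n ih =>
    simp only [parentLists, List.mem_flatMap, List.mem_map, List.mem_range] at h
    obtain ⟨qs, hqs, p, -, rfl⟩ := h
    simp [ih hqs]

namespace SimpleGraph

variable {V : Type*} {G : SimpleGraph V}

theorem IsAcyclic.dist_induce (hG : G.IsAcyclic) {s : Set V} (hs : (G.induce s).Connected)
    (u v : s) : (G.induce s).dist u v = G.dist u v := by
  obtain ⟨p, hp, hlen⟩ := hs.exists_path_of_dist u v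
  let q : G.Walk u v := p.map (Embedding.induce s).toHom
  have hq : q.IsPath := hp.map Subtype.val_injective
  obtain ⟨r, hr, hrlen⟩ := q.reachable.exists_path_of_dist
  have := hG.subsingleton_path (u : V) v
  have hqr : q = r := congrArg Subtype.val (Subsingleton.elim (⟨q, hq⟩ : G.Path u v) ⟨r, hr⟩)
  rw [← hlen, ← hrlen, ← hqr]
  exact (Walk.length_map _ p).symm

theorem Connected.dist_eq_dist_add_one_of_unique_adj (hG : G.Connected) {v w u : V}
    (hadj : G.Adj v w) (huniq : ∀ x, G.Adj v x → x = w) (hu : u ≠ v) :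
    G.dist v u = G.dist w u + 1 := by
  apply le_antisymm
  · have h := hG.dist_triangle (u := v) (v := w) (w := u)
    rw [dist_eq_one_iff_adj.mpr hadj] at h
    omega
  · obtain ⟨p, hp⟩ := hG.exists_walk_length_eq_dist v u
    cases p with
    | nil => exact absurd rfl hu
    | cons h q =>
      obtain rfl := huniq _ h
      rw [← hp, Walk.length_cons]
      exact Nat.succ_le_succ (dist_le q)

/-- Every tree on `n + 1` vertices is isometric to one given by a parent list. -/
theorem IsTree.exists_parentDist {n : ℕ} {V : Type*} [Fintype V] {G : SimpleGraph V}
    (hG : G.IsTree) (hn : Fintype.card V = n + 1) :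
    ∃ ps ∈ parentLists n, ∃ f : V → ℕ, Function.Injective f ∧ (∀ u, f u < n + 1) ∧
      ∀ u v, G.dist u v = parentDist ps (f u) (f v) := by
  classical
  induction n generalizing V with
  | zero =>
    have : Subsingleton V := Fintype.card_le_one_iff_subsingleton.mp hn.le
    refine ⟨[], by simp [parentLists], fun _ => 0, Function.injective_of_subsingleton _,
      fun _ => Nat.one_pos, fun u v => ?_⟩
    simp [Subsingleton.elim u v, parentDist]
  | succ n ih =>
    have : Nontrivial V := Fintype.one_lt_card_iff_nontrivial.mp (by omega)
    obtain ⟨v, hv⟩ := hG.exists_vert_degree_one_of_nontrivial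
    obtain ⟨w, hvw, hw⟩ := degree_eq_one_iff_existsUnique_adj.mp hv
    have hconn := hG.connected.induce_compl_singleton_of_degree_eq_one hv
    have hcard : Fintype.card ({v}ᶜ : Set V) = n + 1 := by
      rw [Fintype.card_compl_set, hn]
      simp
    obtain ⟨ps, hps, f, hf, hfn, hd⟩ := ih ⟨hconn, hG.isAcyclic.induce _⟩ hcard
    have hlen := length_of_mem_parentLists hps
    have hwv : w ∈ ({v}ᶜ : Set V) := hvw.ne'
    let g : V → ℕ := fun u => if h : u = v then n + 1 else f ⟨u, h⟩
    have hgv : g v = n + 1 := dif_pos rfl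
    have hg (u : V) (h : u ≠ v) : g u = f ⟨u, h⟩ := dif_neg h
    have hg_ne (u : V) (h : u ≠ v) : g u ≠ n + 1 := by
      rw [hg u h]
      exact (hfn _).ne
    have hg_beq (u : V) (h : u ≠ v) : (g u == n + 1) = false := beq_false_of_ne (hg_ne u h)
    have hdist (u : V) (hu : u ≠ v) (x : V) (hx : x ≠ v) :
        G.dist u x = parentDist ps (g u) (g x) := by
      rw [hg u hu, hg x hx, ← hd, hG.isAcyclic.dist_induce hconn]
    refine ⟨g w :: ps, ?_, g, ?_, ?_, ?_⟩
    · simp only [parentLists, List.mem_flatMap, List.mem_map, List.mem_range]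
      exact ⟨ps, hps, g w, by rw [hg w hwv]; exact hfn _, rfl⟩
    · intro a b hab
      by_cases ha : a = v <;> by_cases hb : b = v
      · rw [ha, hb]
      · subst ha
        exact absurd (hab.symm.trans hgv) (hg_ne b hb)
      · subst hb
        exact absurd (hab.trans hgv) (hg_ne a ha)
      · rw [hg a ha, hg b hb] at hab
        exact congrArg Subtype.val (hf hab)
    · intro u
      by_cases hu : u = v
      · subst hu
        omega
      · rw [hg u hu]
        exact (hfn _).trans (Nat.lt_succ_self _)
    · intro a b
      have hleaf (u : V) (hu : u ≠ v) : G.dist v u = G.dist w u + 1 :=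
        hG.connected.dist_eq_dist_add_one_of_unique_adj hvw hw hu
      by_cases ha : a = v <;> by_cases hb : b = v
      · simp [ha, hb, parentDist, hlen, hgv]
      · simp [ha, parentDist, hlen, hgv, hg_beq b hb, hleaf b hb, hdist w hwv b hb]
      · rw [hb, G.dist_comm, hleaf a ha, G.dist_comm, hdist a ha w hwv]
        simp [parentDist, hlen, hgv, hg_beq a ha]
      · simp [parentDist, hlen, hg_beq a ha, hg_beq b hb, hdist a ha b hb]

end SimpleGraph

theorem numMasks_le_ncard {V : Type*} {n : ℕ} (e : V ≃ Fin n) (d : ℕ → ℕ → ℕ) (b : Bool)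
    (L : V → V → Set V)
    (hL : ∀ u v p, p ∈ L u v ↔ p = u ∨ p = v ∨ collinBool d (e u) (e v) (e p) = b) :
    numMasks d b n ≤ {S | ∃ u v : V, u ≠ v ∧ S = L u v}.ncard := by
  classical
  have : Finite V := Finite.of_equiv _ e.symm
  let mask : Set V → ℕ := fun S => ∑ k : Fin n, if e.symm k ∈ S then 2 ^ (k : ℕ) else 0
  have hmask (i j : Fin n) : mask (L (e.symm i) (e.symm j)) = lineMask d b n i j := by
    have hsum (F : ℕ → ℕ) : ((List.range n).map F).sum = ∑ k : Fin n, F k := by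
      rw [Fin.sum_univ_eq_sum_range]
      rfl
    rw [lineMask, hsum]
    refine Finset.sum_congr rfl fun k _ => ?_
    simp [hL, Bool.cond_eq_ite, Fin.ext_iff, or_assoc]
  unfold numMasks
  rw [← List.card_toFinset, ← Set.ncard_coe_finset]
  refine le_trans (Set.ncard_le_ncard ?_ (Set.toFinite _))
    (Set.ncard_image_le (f := mask) (Set.toFinite _))
  intro m hm
  simp only [List.coe_toFinset, List.mem_flatMap, List.mem_map, List.mem_range,
    Set.mem_ofPred_eq] at hm
  obtain ⟨i, hi, j, hj, rfl⟩ := hm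
  refine ⟨_, ⟨e.symm ⟨i, hi⟩, e.symm ⟨j, hj.trans hi⟩, ?_, rfl⟩, hmask _ _⟩
  simp [hj.ne']

theorem card_lines_of_manyLines {V : Type*} [Fintype V] {G : SimpleGraph V} (hG : G.IsTree) {n : ℕ}
    (hn : Fintype.card V = n + 1) (h : manyLines n = true) :
    (n + 1) * n / 2 + 1 ≤ treeNumRed G + treeNumBlue G := by
  obtain ⟨ps, hps, f, hf, hfn, hd⟩ := hG.exists_parentDist hn
  let e : V ≃ Fin (n + 1) := Equiv.ofBijective (fun u => ⟨f u, hfn u⟩)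
    ((Fintype.bijective_iff_injective_and_card _).mpr
      ⟨fun a b hab => hf (congrArg Fin.val hab), by simp [hn]⟩)
  have hcollin (u v p : V) :
      Collin G u v p ↔ collinBool (parentDist ps) (e u) (e v) (e p) = true := by
    simp [Collin, collinBool, hd, e, or_assoc]
  refine (Nat.le_of_ble_eq_true (List.all_eq_true.mp h ps hps)).trans (Nat.add_le_add ?_ ?_)
  · refine numMasks_le_ncard e _ _ _ fun u v p => ?_
    rw [← hcollin]
    simp only [treeRedLine, Set.mem_union, Set.mem_insert_iff, Set.mem_singleton_iff,
      Set.mem_ofPred_eq]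
    tauto
  · refine numMasks_le_ncard e _ _ _ fun u v p => ?_
    rw [← Bool.not_eq_true, ← hcollin]
    simp only [treeBlueLine, Set.mem_union, Set.mem_insert_iff, Set.mem_singleton_iff,
      Set.mem_ofPred_eq]
    tauto

/-- For the system derived from a tree on `n` vertices with `3 ≤ n ≤ 6`,
`m_S ≥ n(n−1)/2 + 1`. -/
theorem stmt_17 {V : Type*} [Fintype V] (G : SimpleGraph V) (hG : G.IsTree)
    (hn3 : 3 ≤ Fintype.card V) (hn6 : Fintype.card V ≤ 6) :
    Fintype.card V * (Fintype.card V - 1) / 2 + 1 ≤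
      treeNumRed G + treeNumBlue G := by
  obtain ⟨n, hn⟩ : ∃ n, Fintype.card V = n + 1 := ⟨_, (Nat.sub_add_cancel (by omega)).symm⟩
  rw [hn] at hn3 hn6 ⊢
  refine card_lines_of_manyLines hG hn ?_
  obtain rfl | rfl | rfl | rfl : n = 2 ∨ n = 3 ∨ n = 4 ∨ n = 5 := by omega
  exacts [manyLines_two, manyLines_three, manyLines_four, manyLines_five]
end
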